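/- Suppose the labeled graph (E,L) has no sinks or sources. Let {s_a, p_A} be a representation of (E,L,𝔅̄) in a C*-algebra B generated by {s_a} ∪ {p_A}, with p_C ≠ 0 for every nonempty C ∈ 𝔅̄ and admitting a gauge action. Let α ∈ L*(E) be a repeatable path. If for some m ≥ 1 the projection p_{r(α^m)} does not belong to the closed two-sided ideal of B generated by the projection p_{r(α^m) ∖ r(α^{m+1})}, then B is not an AF algebra. -/

import Mathlib

/-! # Common framework for labeled graph C*-algebras

Directed graphs, finite paths, labeled spaces `(E, L, 𝔅̄)` where `𝔅̄` is the
smallest accommodating set closed under relative complements (and containing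
the sink parts of its members), loops and generalized loops, representations
of labeled spaces in C*-algebras, gauge actions, infinite projections,
AF algebras, and closed two-sided ideals. -/

noncomputable section

/-- A directed graph with vertex set `V` and edge set `E`. -/
structure DirGraph (V : Type*) (E : Type*) where
  src : E → V
  rng : E → V

variable {V E 𝒜 : Type*}

/-- A (finite) path of positive length in a directed graph: a nonempty list of
composable edges. -/
structure GPath (G : DirGraph V E) where
  edges : List E
  ne : edges ≠ []
  chain : edges.Chain' fun e f => G.rng e = G.src f

namespace GPath

variable {G : DirGraph V E}

/-- The source vertex of a path. -/
def source (p : GPath G) : V := G.src (p.edges.head p.ne)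

/-- The range vertex of a path. -/
def range (p : GPath G) : V := G.rng (p.edges.getLast p.ne)

/-- The length of a path. -/
def length (p : GPath G) : ℕ := p.edges.length

/-- The label word of a path under a labeling `L`. -/
def label (L : E → 𝒜) (p : GPath G) : List 𝒜 := p.edges.map L

end GPath

/-- The set of sinks of a graph (vertices emitting no edge). -/
def DirGraph.sinks (G : DirGraph V E) : Set V := {v | ∀ e, G.src e ≠ v}

/-- `w ∈ L*(E)`: `w` is the label of some path of positive length. -/
def IsLabelWord (G : DirGraph V E) (L : E → 𝒜) (w : List 𝒜) : Prop :=
  ∃ p : GPath G, p.label L = w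

/-- The range `r(w)` of a labeled path `w`. -/
def rngW (G : DirGraph V E) (L : E → 𝒜) (w : List 𝒜) : Set V :=
  {v | ∃ p : GPath G, p.label L = w ∧ p.range = v}

/-- The relative range `r(A, w)` of a labeled path `w` with respect to `A`. -/
def relRng (G : DirGraph V E) (L : E → 𝒜) (A : Set V) (w : List 𝒜) : Set V :=
  {v | ∃ p : GPath G, p.label L = w ∧ p.source ∈ A ∧ p.range = v}

/-- `L(A E^n)`: labels of paths of length exactly `n` with source in `A`. -/
def labelsFromLen (G : DirGraph V E) (L : E → 𝒜) (A : Set V) (n : ℕ) : Set (List 𝒜) :=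
  {w | ∃ p : GPath G, p.source ∈ A ∧ p.length = n ∧ p.label L = w}

/-- `L(A E^{≤n})`: labels of paths of length between `1` and `n` with source in `A`. -/
def labelsFromLe (G : DirGraph V E) (L : E → 𝒜) (A : Set V) (n : ℕ) : Set (List 𝒜) :=
  {w | ∃ p : GPath G, p.source ∈ A ∧ p.length ≤ n ∧ p.label L = w}

/-- `L(A E^{≥n})`: labels of paths of length at least `n` (and at least `1`)
with source in `A`. -/
def labelsFromGe (G : DirGraph V E) (L : E → 𝒜) (A : Set V) (n : ℕ) : Set (List 𝒜) :=
  {w | ∃ p : GPath G, p.source ∈ A ∧ n ≤ p.length ∧ p.label L = w}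

/-- `L(E^n A)`: labels of paths of length exactly `n` with range in `A`. -/
def labelsToLen (G : DirGraph V E) (L : E → 𝒜) (n : ℕ) (A : Set V) : Set (List 𝒜) :=
  {w | ∃ p : GPath G, p.range ∈ A ∧ p.length = n ∧ p.label L = w}

/-- `L(E^{≤l} v)`: labels of paths of length between `1` and `l` with range `v`. -/
def labelsToLe (G : DirGraph V E) (L : E → 𝒜) (l : ℕ) (v : V) : Set (List 𝒜) :=
  {w | ∃ p : GPath G, p.range = v ∧ p.length ≤ l ∧ p.label L = w}

/-- `𝔅̄`: the smallest accommodating set for `(E, L)` (containing the ranges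
`r(α)` for `α ∈ L*(E)` and closed under relative ranges, finite intersections
and finite unions) that is moreover closed under relative complements and
contains `A_sk = A ∩ sinks` for every `A` belonging to it. -/
inductive Bbar (G : DirGraph V E) (L : E → 𝒜) : Set V → Prop
  | base (w : List 𝒜) (hw : IsLabelWord G L w) : Bbar G L (rngW G L w)
  | rel (A : Set V) (w : List 𝒜) (hA : Bbar G L A) (hw : IsLabelWord G L w) :
      Bbar G L (relRng G L A w)
  | inter (A B : Set V) (hA : Bbar G L A) (hB : Bbar G L B) : Bbar G L (A ∩ B)
  | union (A B : Set V) (hA : Bbar G L A) (hB : Bbar G L B) : Bbar G L (A ∪ B)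
  | diff (A B : Set V) (hA : Bbar G L A) (hB : Bbar G L B) : Bbar G L (A \ B)
  | sk (A : Set V) (hA : Bbar G L A) : Bbar G L (A ∩ G.sinks)

/-- The standing assumptions on a labeled space `(E, L, 𝔅̄)`: weakly
left-resolving, set-finite, receiver set-finite, and no sink is a source. -/
structure StandingAssumptions (G : DirGraph V E) (L : E → 𝒜) : Prop where
  wlr : ∀ A B : Set V, Bbar G L A → Bbar G L B → ∀ w : List 𝒜, IsLabelWord G L w →
    relRng G L A w ∩ relRng G L B w = relRng G L (A ∩ B) w
  setFinite : ∀ A : Set V, Bbar G L A → ∀ n : ℕ, 1 ≤ n → (labelsFromLen G L A n).Finite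
  receiverSetFinite : ∀ A : Set V, Bbar G L A → ∀ n : ℕ, 1 ≤ n → (labelsToLen G L n A).Finite
  sinkNotSource : ∀ v ∈ G.sinks, ∃ e, G.rng e = v

/-- The `n`-fold concatenation `w^n` of a word `w`. -/
def wordPow (w : List 𝒜) (n : ℕ) : List 𝒜 := (List.replicate n w).flatten

/-- A labeled path is repeatable if all its powers `w^n`, `n ≥ 1`, are again
labeled paths. -/
def Repeatable (G : DirGraph V E) (L : E → 𝒜) (w : List 𝒜) : Prop :=
  ∀ n : ℕ, 1 ≤ n → IsLabelWord G L (wordPow w n)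

/-- The generalized vertex `[v]_l`: all non-source vertices receiving exactly
the same labeled paths of length at most `l` as `v` does. -/
def gvtx (G : DirGraph V E) (L : E → 𝒜) (l : ℕ) (v : V) : Set V :=
  {u | (∃ e, G.rng e = u) ∧ labelsToLe G L l u = labelsToLe G L l v}

/-- A generalized loop at `A`: a labeled path `α ∈ L(A E^{≥1} A)`. -/
def IsGenLoop (G : DirGraph V E) (L : E → 𝒜) (A : Set V) (α : List 𝒜) : Prop :=
  ∃ p : GPath G, p.label L = α ∧ p.source ∈ A ∧ p.range ∈ A

/-- A loop at `A`: a generalized loop `α` at `A` such that `A ⊆ r(A, α)`. -/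
def IsLoop (G : DirGraph V E) (L : E → 𝒜) (A : Set V) (α : List 𝒜) : Prop :=
  IsGenLoop G L A α ∧ A ⊆ relRng G L A α

/-- The nonempty initial segments (initial paths) of a word `α`. -/
def initialSegs (α : List 𝒜) : Set (List 𝒜) := {w | w ≠ [] ∧ w <+: α}

/-- A loop `α` at `A` has an exit if (i) the initial segments of `α` form a
proper subset of `L(A E^{≤|α|})`, or (ii) `r(A, α_{[1,i]})` contains a sink for
some `1 ≤ i ≤ |α|`, or (iii) `A` is a proper subset of `r(A, α)`. -/
def HasExitLoop (G : DirGraph V E) (L : E → 𝒜) (A : Set V) (α : List 𝒜) : Prop :=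
  initialSegs α ⊂ labelsFromLe G L A α.length ∨
  (∃ k : ℕ, 1 ≤ k ∧ k ≤ α.length ∧ (relRng G L A (α.take k) ∩ G.sinks).Nonempty) ∨
  A ⊂ relRng G L A α

/-- `A_0 E^{≤K} A_1 ⋯ E^{≤K} A_m ≠ ∅`: existence of `m` consecutively
composable paths, each of length between `1` and `K`, the `j`-th going from
`As j` to `As (j+1)`. -/
def ChainExists (G : DirGraph V E) (As : ℕ → Set V) (K m : ℕ) : Prop :=
  ∃ xs : Fin m → GPath G,
    (∀ j : Fin m, (xs j).length ≤ K ∧ (xs j).source ∈ As j.val ∧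
      (xs j).range ∈ As (j.val + 1)) ∧
    ∀ (j : ℕ) (h : j + 1 < m),
      (xs ⟨j, Nat.lt_of_succ_lt h⟩).range = (xs ⟨j + 1, h⟩).source

/-- Same as `ChainExists` but with all paths of length exactly `K`
(i.e. `A_0 E^K A_1 ⋯ E^K A_m ≠ ∅`). -/
def ChainExistsExact (G : DirGraph V E) (As : ℕ → Set V) (K m : ℕ) : Prop :=
  ∃ xs : Fin m → GPath G,
    (∀ j : Fin m, (xs j).length = K ∧ (xs j).source ∈ As j.val ∧
      (xs j).range ∈ As (j.val + 1)) ∧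
    ∀ (j : ℕ) (h : j + 1 < m),
      (xs ⟨j, Nat.lt_of_succ_lt h⟩).range = (xs ⟨j + 1, h⟩).source

/-- Condition (a): for every finite family `A_1, …, A_N` in `𝔅̄` and every
`K ≥ 1` there is `m₀ ≥ 1` such that
`A_{i_1} E^{≤K} A_{i_2} ⋯ E^{≤K} A_{i_n} = ∅` (`n` sets, `n - 1` path factors)
for all `n > m₀` and all choices of indices. -/
def CondA (G : DirGraph V E) (L : E → 𝒜) : Prop :=
  ∀ (N : ℕ) (As : Fin N → Set V), (∀ i, Bbar G L (As i)) → ∀ K : ℕ, 1 ≤ K →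
    ∃ m0 : ℕ, 1 ≤ m0 ∧ ∀ n : ℕ, m0 < n → ∀ ι : ℕ → Fin N,
      ¬ ChainExists G (fun j => As (ι j)) K (n - 1)

/-- A word is agreeable (for level `l`) if it is of the form `β^k β'` with
`β, β' ∈ L(E^{≤l})` and `β'` a nonempty initial segment of `β`. -/
def AgreeableW (G : DirGraph V E) (L : E → 𝒜) (l : ℕ) (α : List 𝒜) : Prop :=
  ∃ (k : ℕ) (β β' : List 𝒜), IsLabelWord G L β ∧ IsLabelWord G L β' ∧
    β.length ≤ l ∧ β' ≠ [] ∧ β' <+: β ∧ α = wordPow β k ++ β'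

/-- A representation of the labeled space `(E, L, 𝔅̄)` in a (C*-)algebra `B`:
projections `p A`, `A ∈ 𝔅̄`, and partial isometries `s a`, `a ∈ 𝒜`, satisfying
the defining relations of a labeled graph C*-algebra. -/
structure LRep (G : DirGraph V E) (L : E → 𝒜) (B : Type*)
    [NonUnitalRing B] [StarRing B] where
  p : Set V → B
  s : 𝒜 → B
  p_empty : p ∅ = 0
  p_sa : ∀ A : Set V, Bbar G L A → star (p A) = p A
  p_mul : ∀ A A' : Set V, Bbar G L A → Bbar G L A' → p A * p A' = p (A ∩ A')
  p_union : ∀ A A' : Set V, Bbar G L A → Bbar G L A' →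
    p (A ∪ A') = p A + p A' - p (A ∩ A')
  s_pi : ∀ a : 𝒜, s a * star (s a) * s a = s a
  p_s : ∀ (A : Set V) (a : 𝒜), Bbar G L A → p A * s a = s a * p (relRng G L A [a])
  s_s : ∀ a : 𝒜, star (s a) * s a = p (rngW G L [a])
  s_orth : ∀ a b : 𝒜, a ≠ b → star (s a) * s b = 0
  ck : ∀ A : Set V, Bbar G L A →
    p A = (∑ᶠ a ∈ {a : 𝒜 | ∃ e, G.src e ∈ A ∧ L e = a},
      s a * p (relRng G L A [a]) * star (s a)) + p (A ∩ G.sinks)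

/-- `s_α` for a word `α`: the product of the partial isometries of its letters
(junk value `0` on the empty word, which is never used). -/
def sWord {B : Type*} [NonUnitalRing B] (s : 𝒜 → B) : List 𝒜 → B
  | [] => 0
  | [a] => s a
  | a :: b :: w => s a * sWord s (b :: w)

/-- The range of a word in `L^#(E)` (`none` is the empty word, with range all
of `E^0`). -/
def owordRng (G : DirGraph V E) (L : E → 𝒜) : Option (List 𝒜) → Set V
  | none => Set.univ
  | some w => rngW G L w

/-- The relative range of a word in `L^#(E)` with respect to `A` (`none` is
the empty word, with `r(A, ε) = A`). -/
def relRngE (G : DirGraph V E) (L : E → 𝒜) (A : Set V) : Option (List 𝒜) → Set V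
  | none => A
  | some w => relRng G L A w

/-- The element `s_α p_A s_β*` of a representation, where `α`, `β` are words in
`L^#(E)` (`none` being the empty word `ε` with `s_ε` the identity). -/
def LRep.elt {B : Type*} [NonUnitalRing B] [StarRing B] {G : DirGraph V E} {L : E → 𝒜}
    (rep : LRep G L B) : Option (List 𝒜) → Set V → Option (List 𝒜) → B
  | none, A, none => rep.p A
  | some α, A, none => sWord rep.s α * rep.p A
  | none, A, some β => rep.p A * star (sWord rep.s β)
  | some α, A, some β => sWord rep.s α * rep.p A * star (sWord rep.s β)

/-- A projection `q` is infinite if there is a partial isometry `u` with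
`u* u = q`, `u u* ≤ q` and `u u* ≠ q`. -/
def IsInfiniteProjection (B : Type*) [NonUnitalRing B] [StarRing B] [PartialOrder B]
    (q : B) : Prop :=
  star q = q ∧ q * q = q ∧ ∃ u : B, star u * u = q ∧ u * star u ≤ q ∧ u * star u ≠ q

/-- A C*-algebra is AF if every finite subset can be approximated within any
`ε > 0` from a finite-dimensional *-subalgebra. -/
def IsAFAlgebra (B : Type*) [NonUnitalNormedRing B] [StarRing B] [NormedSpace ℂ B] : Prop :=
  ∀ (F : Finset B) (ε : ℝ), 0 < ε →
    ∃ D : NonUnitalStarSubalgebra ℂ B, FiniteDimensional ℂ D ∧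
      ∀ x ∈ F, ∃ y ∈ (D : Set B), ‖x - y‖ < ε

/-- A gauge action for a representation: a strongly continuous action of the
circle group by *-automorphisms fixing the projections and scaling the
generating partial isometries. -/
structure GaugeAction {B : Type*} [NonUnitalCStarAlgebra B]
    (G : DirGraph V E) (L : E → 𝒜) (rep : LRep G L B) where
  γ : Circle → B ≃⋆ₐ[ℂ] B
  γ_mul : ∀ z w : Circle, γ (z * w) = (γ w).trans (γ z)
  γ_continuous : ∀ x : B, Continuous fun z => γ z x
  γ_s : ∀ (z : Circle) (a : 𝒜), γ z (rep.s a) = (z : ℂ) • rep.s a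
  γ_p : ∀ (z : Circle) (A : Set V), Bbar G L A → γ z (rep.p A) = rep.p A

/-- The representation generates `B` as a C*-algebra. -/
def GeneratesAlg {B : Type*} [NonUnitalCStarAlgebra B]
    (G : DirGraph V E) (L : E → 𝒜) (rep : LRep G L B) : Prop :=
  closure (NonUnitalStarAlgebra.adjoin ℂ
    ({x : B | ∃ a : 𝒜, x = rep.s a} ∪ {x : B | ∃ A : Set V, Bbar G L A ∧ x = rep.p A}) : Set B)
    = Set.univ

/-- A closed two-sided ideal of a C*-algebra (as a set). -/
def IsClosedTwoSidedIdealSet (B : Type*) [NonUnitalNormedRing B] [NormedSpace ℂ B]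
    (I : Set B) : Prop :=
  IsClosed I ∧ (0 : B) ∈ I ∧ (∀ x ∈ I, ∀ y ∈ I, x + y ∈ I) ∧
    (∀ (c : ℂ), ∀ x ∈ I, c • x ∈ I) ∧ ∀ x ∈ I, ∀ y : B, x * y ∈ I ∧ y * x ∈ I

/-- The closed two-sided ideal generated by an element. -/
def closedIdealGen (B : Type*) [NonUnitalNormedRing B] [NormedSpace ℂ B] (q : B) : Set B :=
  ⋂₀ {I : Set B | IsClosedTwoSidedIdealSet B I ∧ q ∈ I}


/-! ## Part 1: the Banach algebra core -/

/-- A unital Banach algebra which is locally approximated by finite dimensional subalgebras. -/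
def LocFin (A : Type*) [NormedRing A] [NormedAlgebra ℂ A] : Prop :=
  ∀ (F : Finset A) (ε : ℝ), 0 < ε → ∃ D : Subalgebra ℂ A, FiniteDimensional ℂ D ∧
    ∀ x ∈ F, ∃ y ∈ D, ‖x - y‖ < ε

section core
variable {A : Type*} [NormedRing A] [NormedAlgebra ℂ A]

lemma trace_lt (D : Subalgebra ℂ A) [FiniteDimensional ℂ D] [Nontrivial D] (d : D)
    (hd : ‖(d : A)‖ < 1) :
    ‖LinearMap.trace ℂ D (LinearMap.mulLeft ℂ d)‖ < Module.finrank ℂ D := by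
  set T : Module.End ℂ D := LinearMap.mulLeft ℂ d with hT
  have hs : T.charpoly.Splits := IsAlgClosed.splits _
  have h1 : LinearMap.trace ℂ D T = T.charpoly.roots.sum :=
    Module.End.trace_eq_sum_roots_charpoly_of_splits hs
  have h2 : T.charpoly.roots.card = Module.finrank ℂ D := by
    rw [← hs.natDegree_eq_card_roots, LinearMap.charpoly_natDegree]
  have h3 : ∀ μ ∈ T.charpoly.roots, ‖μ‖ ≤ ‖(d : A)‖ := by
    intro μ hμ
    have hr : T.charpoly.IsRoot μ := (Polynomial.mem_roots'.1 hμ).2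
    have he := (Module.End.hasEigenvalue_iff_isRoot_charpoly T μ).2 hr
    obtain ⟨y, hy⟩ := he.exists_hasEigenvector
    have hy0 : y ≠ 0 := hy.2
    have hy1 : d * y = μ • y := hy.apply_eq_smul
    have hy2 : (d : A) * (y : A) = μ • (y : A) := by
      have := congrArg (Subtype.val) hy1
      simpa using this
    have hypos : 0 < ‖(y : A)‖ := by
      rw [norm_pos_iff]; intro h; exact hy0 (Subtype.ext h)
    have : ‖μ‖ * ‖(y : A)‖ ≤ ‖(d : A)‖ * ‖(y : A)‖ := by
      rw [← norm_smul, ← hy2]; exact norm_mul_le _ _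
    exact le_of_mul_le_mul_right this hypos
  have h4 : ‖T.charpoly.roots.sum‖ ≤ T.charpoly.roots.card * ‖(d : A)‖ := by
    generalize T.charpoly.roots = R at h3
    induction R using Multiset.induction_on with
    | empty => simp
    | cons a R ih =>
      have ha := h3 a (by simp)
      have hR := ih (fun μ hμ => h3 μ (by simp [hμ]))
      rw [Multiset.sum_cons, Multiset.card_cons]
      push_cast
      have := norm_add_le a R.sum
      linarith
  rw [h1]
  refine h4.trans_lt ?_
  rw [h2]
  have : (0 : ℝ) < Module.finrank ℂ D := by exact_mod_cast Module.finrank_pos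
  nlinarith

/-- span of the commutators -/
def commSpan (A : Type*) [NormedRing A] [NormedAlgebra ℂ A] : Submodule ℂ A :=
  Submodule.span ℂ {c | ∃ x y : A, c = x * y - y * x}

/-- `D` approximates `F` up to `δ`. -/
def Approx (D : Subalgebra ℂ A) (F : Finset A) (δ : ℝ) : Prop :=
  ∀ x ∈ F, ∃ y ∈ D, ‖x - y‖ < δ

lemma Approx.mono {D : Subalgebra ℂ A} {F F' : Finset A} {δ δ' : ℝ} (h : Approx D F δ)
    (hF : F' ⊆ F) (hδ : δ ≤ δ') : Approx D F' δ' := fun x hx => by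
  obtain ⟨y, hy, h1⟩ := h x (hF hx)
  exact ⟨y, hy, h1.trans_le hδ⟩

lemma commSpan_approx {c : A} (hc : c ∈ commSpan A) :
    ∀ ε : ℝ, 0 < ε → ∃ (F : Finset A) (δ : ℝ), 0 < δ ∧ ∀ D : Subalgebra ℂ A, Approx D F δ →
      ∃ c' : D, ‖c - c'‖ < ε ∧ LinearMap.trace ℂ D (LinearMap.mulLeft ℂ c') = 0 := by
  classical
  unfold commSpan at hc
  induction hc using Submodule.span_induction with
  | mem c hc =>
    obtain ⟨x, y, rfl⟩ := hc
    intro ε hε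
    have hcont : Continuous (fun q : A × A => q.1 * q.2 - q.2 * q.1) := by fun_prop
    obtain ⟨δ, hδ, h⟩ := Metric.continuous_iff.1 hcont (x, y) ε hε
    refine ⟨{x, y}, δ, hδ, fun D hD => ?_⟩
    obtain ⟨x', hx', hx⟩ := hD x (by simp)
    obtain ⟨y', hy', hy⟩ := hD y (by simp)
    refine ⟨⟨x', hx'⟩ * ⟨y', hy'⟩ - ⟨y', hy'⟩ * ⟨x', hx'⟩, ?_, ?_⟩
    · have := h (x', y') (by
        rw [Prod.dist_eq, max_lt_iff]
        simp only [dist_eq_norm]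
        exact ⟨by rwa [norm_sub_rev], by rwa [norm_sub_rev]⟩)
      rw [dist_comm, dist_eq_norm] at this
      simpa using this
    · have : LinearMap.mulLeft ℂ ((⟨x', hx'⟩ : D) * ⟨y', hy'⟩ - ⟨y', hy'⟩ * ⟨x', hx'⟩) =
        LinearMap.mulLeft ℂ (⟨x', hx'⟩ : D) * LinearMap.mulLeft ℂ (⟨y', hy'⟩ : D)
        - LinearMap.mulLeft ℂ (⟨y', hy'⟩ : D) * LinearMap.mulLeft ℂ (⟨x', hx'⟩ : D) := by
        apply LinearMap.ext
        intro z
        simp only [LinearMap.mulLeft_apply, LinearMap.sub_apply, Module.End.mul_apply]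
        noncomm_ring
      rw [this, map_sub, LinearMap.trace_mul_comm, sub_self]
  | zero =>
    intro ε hε
    refine ⟨∅, 1, one_pos, fun D _ => ⟨0, by simpa using hε, by simp⟩⟩
  | add x y _ _ hx hy =>
    intro ε hε
    obtain ⟨F, δ, hδ, hF⟩ := hx (ε / 2) (by positivity)
    obtain ⟨F', δ', hδ', hF'⟩ := hy (ε / 2) (by positivity)
    refine ⟨F ∪ F', min δ δ', lt_min hδ hδ', fun D hD => ?_⟩
    obtain ⟨a, ha, ha'⟩ := hF D (hD.mono Finset.subset_union_left (min_le_left _ _))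
    obtain ⟨b, hb, hb'⟩ := hF' D (hD.mono Finset.subset_union_right (min_le_right _ _))
    refine ⟨a + b, ?_, ?_⟩
    · have : x + y - ((a + b : D) : A) = (x - a) + (y - b) := by push_cast; abel
      rw [this]
      linarith [norm_add_le (x - (a : A)) (y - b)]
    · have : LinearMap.mulLeft ℂ (a + b) = LinearMap.mulLeft ℂ a + LinearMap.mulLeft ℂ b := by
        apply LinearMap.ext; intro z; simp [add_mul]
      rw [this, map_add, ha', hb', add_zero]
  | smul r x _ hx =>
    intro ε hε
    obtain ⟨F, δ, hδ, hF⟩ := hx (ε / (‖r‖ + 1)) (by positivity)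
    refine ⟨F, δ, hδ, fun D hD => ?_⟩
    obtain ⟨a, ha, ha'⟩ := hF D hD
    refine ⟨r • a, ?_, ?_⟩
    · have : r • x - ((r • a : D) : A) = r • (x - a) := by push_cast; rw [smul_sub]
      rw [this, norm_smul]
      rw [lt_div_iff₀ (by positivity)] at ha
      nlinarith [norm_nonneg (x - (a : A)), norm_nonneg r]
    · have : LinearMap.mulLeft ℂ (r • a) = r • LinearMap.mulLeft ℂ a := by
        apply LinearMap.ext; intro z; simp
      rw [this, map_smul, ha', smul_zero]

lemma exists_trace [Nontrivial A] (hA : LocFin A) :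
    ∃ τ : A →L[ℂ] ℂ, τ 1 = 1 ∧ ∀ x y, τ (x * y) = τ (y * x) := by
  have h1 : (1 : A) ∉ (commSpan A).topologicalClosure := by
    intro h
    have h' : (1 : A) ∈ closure (commSpan A : Set A) := h
    rw [Metric.mem_closure_iff] at h'
    obtain ⟨c, hc, hc1⟩ := h' (1 / 2) (by norm_num)
    obtain ⟨F, δ, hδ, hF⟩ := commSpan_approx hc (1 / 2) (by norm_num)
    obtain ⟨D, hD, hDF⟩ := hA F δ hδ
    obtain ⟨c', h2, h3⟩ := hF D hDF
    have h4 : ‖((1 - c' : D) : A)‖ < 1 := by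
      have : ((1 - c' : D) : A) = (1 - c) + (c - c') := by push_cast; abel
      rw [this]
      rw [dist_eq_norm] at hc1
      linarith [norm_add_le (1 - c) (c - (c' : A))]
    have h5 := trace_lt D (1 - c') h4
    have : LinearMap.mulLeft ℂ (1 - c') = 1 - LinearMap.mulLeft ℂ c' := by
      apply LinearMap.ext; intro z; simp [sub_mul]
    rw [this, map_sub, h3, sub_zero, LinearMap.trace_one] at h5
    simp at h5
  set M := (commSpan A).topologicalClosure with hM
  have : IsClosed (M : Set A) := (commSpan A).isClosed_topologicalClosure
  have h2 : (Submodule.Quotient.mk 1 : A ⧸ M) ≠ 0 := by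
    rw [Ne, Submodule.Quotient.mk_eq_zero]; exact h1
  obtain ⟨f, hf⟩ := SeparatingDual.exists_eq_one (R := ℂ) h2
  have hq : Continuous (M.mkQ) := by
    exact continuous_quot_mk
  refine ⟨f.comp ⟨M.mkQ, hq⟩, by simpa using hf, fun x y => ?_⟩
  have : (M.mkQ (x * y) : A ⧸ M) = M.mkQ (y * x) := by
    rw [← sub_eq_zero, ← map_sub, Submodule.mkQ_apply, Submodule.Quotient.mk_eq_zero]
    exact subset_closure (Submodule.subset_span ⟨x, y, rfl⟩)
  show f (M.mkQ (x * y)) = f (M.mkQ (y * x))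
  rw [this]

end core
section core2
variable {A : Type*} [NormedRing A] [NormedAlgebra ℂ A]

open Real in
lemma exists_inv_trace [Nontrivial A] (hA : LocFin A) (γ : ℝ → A →ₐ[ℂ] A)
    (hadd : ∀ s t x, γ (s + t) x = γ t (γ s x)) (hper : ∀ s x, γ (s + 2 * π) x = γ s x)
    (hcont : ∀ x, Continuous fun θ => γ θ x) (hbd : ∀ θ x, ‖γ θ x‖ ≤ ‖x‖) :
    ∃ τ : A →L[ℂ] ℂ, τ 1 = 1 ∧ (∀ x y, τ (x * y) = τ (y * x)) ∧ ∀ θ x, τ (γ θ x) = τ x := by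
  obtain ⟨τ, h1, h2⟩ := exists_trace hA
  have hc : ∀ x, Continuous fun θ => τ (γ θ x) := fun x => τ.continuous.comp (hcont x)
  have hi : ∀ x, IntervalIntegrable (fun θ => τ (γ θ x)) MeasureTheory.volume 0 (2 * π) :=
    fun x => (hc x).intervalIntegrable _ _
  let σ₀ : A →ₗ[ℂ] ℂ :=
    { toFun := fun x => ((2 * π : ℝ) : ℂ)⁻¹ * ∫ θ in (0 : ℝ)..(2 * π), τ (γ θ x)
      map_add' := fun x y => by
        simp only [map_add]
        rw [intervalIntegral.integral_add (hi x) (hi y), mul_add]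
      map_smul' := fun c x => by
        simp only [map_smul, smul_eq_mul, RingHom.id_apply]
        rw [intervalIntegral.integral_const_mul]
        ring }
  have hpi : (0 : ℝ) < 2 * π := by positivity
  have hpi' : ((2 * π : ℝ) : ℂ) ≠ 0 := by exact_mod_cast hpi.ne'
  let σ : A →L[ℂ] ℂ := σ₀.mkContinuous ‖τ‖ (fun x => by
    show ‖((2 * π : ℝ) : ℂ)⁻¹ * ∫ θ in (0 : ℝ)..(2 * π), τ (γ θ x)‖ ≤ _
    have : ‖∫ θ in (0 : ℝ)..(2 * π), τ (γ θ x)‖ ≤ (‖τ‖ * ‖x‖) * |2 * π - 0| := by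
      apply intervalIntegral.norm_integral_le_of_norm_le_const
      intro θ _
      exact (τ.le_opNorm _).trans (mul_le_mul_of_nonneg_left (hbd θ x) (norm_nonneg _))
    rw [norm_mul, norm_inv, Complex.norm_real, Real.norm_of_nonneg hpi.le]
    rw [sub_zero, abs_of_pos hpi] at this
    rw [inv_mul_le_iff₀ hpi]
    linarith)
  have hσ : ∀ x, σ x = ((2 * π : ℝ) : ℂ)⁻¹ * ∫ θ in (0 : ℝ)..(2 * π), τ (γ θ x) := fun x => rfl
  refine ⟨σ, ?_, ?_, ?_⟩
  · rw [hσ]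
    simp only [map_one, h1]
    rw [intervalIntegral.integral_const, sub_zero]
    simp only [Complex.real_smul, mul_one]
    exact inv_mul_cancel₀ hpi'
  · intro x y
    rw [hσ, hσ]
    congr 2
    funext θ
    rw [map_mul (γ θ), map_mul (γ θ), h2]
  · intro s x
    rw [hσ, hσ]
    congr 1
    have hp : Function.Periodic (fun θ => τ (γ θ x)) (2 * π) := fun θ => by simp only [hper]
    have : (fun θ => τ (γ θ (γ s x))) = fun θ => (fun θ' => τ (γ θ' x)) (s + θ) := by
      funext θ; simp only [hadd]
    rw [this, intervalIntegral.integral_comp_add_left (fun θ' => τ (γ θ' x)) s]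
    have := hp.intervalIntegral_add_eq s 0
    rw [zero_add] at this
    rw [add_zero, this]

variable [CompleteSpace A]

lemma hasDerivAt_ringInv {f : ℝ → A} {f' : A} {t : ℝ} (hf : HasDerivAt f f' t) (hu : IsUnit (f t)) :
    HasDerivAt (fun s => Ring.inverse (f s))
      (-(Ring.inverse (f t) * f' * Ring.inverse (f t))) t := by
  obtain ⟨w, hw⟩ := hu
  let _ : NormedAlgebra ℝ A := NormedAlgebra.restrictScalars ℝ ℂ A
  have h := hasFDerivAt_ringInverse (𝕜 := ℝ) w
  rw [hw] at h
  have h2 := h.comp_hasDerivAt t hf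
  have h3 : Ring.inverse (f t) = ↑w⁻¹ := by rw [← hw, Ring.inverse_unit]
  rw [h3]
  have h4 : (-((ContinuousLinearMap.mulLeftRight ℝ A) ↑w⁻¹) ↑w⁻¹) f' = -(↑w⁻¹ * f' * ↑w⁻¹) := rfl
  rw [← h4]
  exact h2

/-- The logarithmic derivative trace is constant along segments of invertible elements. -/
lemma logder_const (γ : ℝ → A →ₐ[ℂ] A) (h0 : ∀ x, γ 0 x = x)
    (τ : A →L[ℂ] ℂ) (hτ : ∀ x y, τ (x * y) = τ (y * x)) (hinv : ∀ θ x, τ (γ θ x) = τ x)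
    {a b a' b' : A} (ha : HasDerivAt (fun θ => γ θ a) a' 0)
    (hb : HasDerivAt (fun θ => γ θ b) b' 0)
    (hu : ∀ t ∈ Set.Icc (0 : ℝ) 1, IsUnit (a + t • (b - a))) :
    τ (Ring.inverse a * a') = τ (Ring.inverse b * b') := by
  let _ : NormedAlgebra ℝ A := NormedAlgebra.restrictScalars ℝ ℂ A
  let w : ℝ → A := fun t => a + t • (b - a)
  let w' : ℝ → A := fun t => a' + t • (b' - a')
  let τr : A →L[ℝ] ℂ := τ.restrictScalars ℝ
  have hw : ∀ t, HasDerivAt w (b - a) t := fun t => by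
    have := ((hasDerivAt_id t).smul_const (b - a)).const_add a
    rw [one_smul] at this
    exact this
  have hw' : ∀ t, HasDerivAt w' (b' - a') t := fun t => by
    have := ((hasDerivAt_id t).smul_const (b' - a')).const_add a'
    rw [one_smul] at this
    exact this
  let f : ℝ → ℂ := fun t => τ (Ring.inverse (w t) * w' t)
  have hf : ∀ t ∈ Set.Icc (0 : ℝ) 1, HasDerivAt f 0 t := by
    intro t ht
    have hwu : IsUnit (w t) := hu t ht
    have h1 := (hasDerivAt_ringInv (hw t) hwu).mul (hw' t)
    have h2 : HasDerivAt f _ t := τr.hasFDerivAt.comp_hasDerivAt t h1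
    -- derivative in the direction of the action
    have e1 : HasDerivAt (fun θ => γ θ (w t)) (w' t) 0 := by
      have := ha.add ((hb.sub ha).const_smul t)
      refine this.congr_of_eventuallyEq (Filter.Eventually.of_forall fun θ => ?_)
      show γ θ (a + t • (b - a)) = γ θ a + t • (γ θ b - γ θ a)
      have : (t • (b - a) : A) = (t : ℂ) • (b - a) := rfl
      rw [map_add, this, map_smul, map_sub]
      rfl
    have e2 : HasDerivAt (fun θ => Ring.inverse (γ θ (w t)))
        (-(Ring.inverse (w t) * w' t * Ring.inverse (w t))) 0 := by
      have := hasDerivAt_ringInv e1 (by rw [h0]; exact hwu)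
      rwa [h0] at this
    have e3 := e2.mul (hb.sub ha)
    have e4 := τr.hasFDerivAt.comp_hasDerivAt 0 e3
    have e5 : (fun θ => τ (Ring.inverse (w t) * (b - a))) =
        (⇑τr ∘ ((fun θ => Ring.inverse (γ θ (w t))) * ((fun θ => γ θ b) - fun θ => γ θ a))) := by
      funext θ
      show _ = τ (Ring.inverse (γ θ (w t)) * (γ θ b - γ θ a))
      rw [← hinv θ (Ring.inverse (w t) * (b - a)), map_mul, map_sub]
      obtain ⟨v, hv⟩ := hwu
      have : γ θ (Ring.inverse (w t)) = Ring.inverse (γ θ (w t)) := by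
        rw [← hv, Ring.inverse_unit]
        have := Ring.inverse_unit (Units.map (γ θ : A →* A) v)
        rw [← map_inv] at this
        simpa using this.symm
      rw [this]
    rw [← e5] at e4
    have e6 := e4.unique (hasDerivAt_const _ _)
    have e7 : τ (-(Ring.inverse (w t) * w' t * Ring.inverse (w t)) * (b - a)
      + Ring.inverse (w t) * (b' - a')) = 0 := by
      have e8 : τ (-(Ring.inverse (w t) * w' t * Ring.inverse (w t)) * (γ 0 b - γ 0 a)
        + Ring.inverse (γ 0 (w t)) * (b' - a')) = 0 := e6
      simpa only [h0] using e8
    convert h2 using 1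
    rw [← e7]
    show _ = τ (_ + _)
    rw [map_add, map_add]
    congr 1
    rw [neg_mul, neg_mul, map_neg, map_neg]
    congr 1
    have := hτ (Ring.inverse (w t) * w' t) (Ring.inverse (w t) * (b - a))
    simpa only [mul_assoc] using this
  have hcst : ∀ t ∈ Set.Icc (0 : ℝ) 1, f t = f 0 := by
    apply constant_of_derivWithin_zero
    · intro t ht; exact (hf t ht).differentiableAt.differentiableWithinAt
    · intro t ht
      have ht' : t ∈ Set.Icc (0 : ℝ) 1 := ⟨ht.1, ht.2.le⟩
      exact (hf t ht').hasDerivWithinAt.derivWithin (uniqueDiffOn_Icc one_pos t ht')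
  have := hcst 1 (by simp)
  simp only [f, w, w', one_smul, zero_smul, add_zero] at this
  rw [← this]
  congr 2 <;> abel_nf

end core2
section core3
variable {A : Type*} [NormedRing A] [NormedAlgebra ℂ A] [CompleteSpace A]

lemma isUnit_val_of_leftInv (D : Subalgebra ℂ A) [FiniteDimensional ℂ D] (x y : D)
    (h : y * x = 1) : x * y = 1 := by
  have h1 : LinearMap.mulLeft ℂ y ∘ₗ LinearMap.mulLeft ℂ x = LinearMap.id := by
    apply LinearMap.ext; intro z; simp [← mul_assoc, h]
  have h2 : LinearMap.mulLeft ℂ x ∘ₗ LinearMap.mulLeft ℂ y = LinearMap.id := by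
    exact (LinearMap.comp_eq_id_comm _ _).1 h1
  have := LinearMap.congr_fun h2 1
  simpa using this

/-- An injective element of a finite dimensional subalgebra is invertible in it. -/
lemma isUnit_of_isUnit_coe (D : Subalgebra ℂ A) [FiniteDimensional ℂ D] (x : D)
    (h : IsUnit (x : A)) : IsUnit x := by
  have hinj : Function.Injective (LinearMap.mulLeft ℂ x) := by
    intro a b hab
    have : (x : A) * a = x * b := congrArg Subtype.val hab
    exact Subtype.ext (h.mul_left_cancel this)
  obtain ⟨y, hy⟩ := (LinearMap.injective_iff_surjective.1 hinj) 1
  have hy' : x * y = 1 := hy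
  exact ⟨⟨x, y, hy', isUnit_val_of_leftInv D y x hy'⟩, rfl⟩

lemma isUnit_of_near_one {x : A} (h : ‖x - 1‖ < 1) : IsUnit x := by
  have := (Units.oneSub (1 - x) (by rwa [norm_sub_rev])).isUnit
  simpa using this

/-- Locally finite dimensional algebras are directly finite. -/
lemma LocFin.isUnit_of_leftInv (hA : LocFin A) {u v : A} (h : v * u = 1) : IsUnit u := by
  classical
  have hcont : Continuous (fun q : A × A => q.2 * q.1) := by fun_prop
  have hcont' : Continuous (fun q : A => v * q) := by fun_prop
  obtain ⟨δ, hδ, h1⟩ := Metric.continuous_iff.1 hcont (u, v) 1 one_pos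
  obtain ⟨δ', hδ', h2⟩ := Metric.continuous_iff.1 hcont' u 1 one_pos
  obtain ⟨D, hD, hF⟩ := hA {u, v} (min δ δ') (lt_min hδ hδ')
  obtain ⟨u', hu', hu⟩ := hF u (by simp)
  obtain ⟨v', hv', hv⟩ := hF v (by simp)
  have h3 := h1 (u', v') (by
        rw [Prod.dist_eq, max_lt_iff]
        simp only [dist_eq_norm]
        exact ⟨by rw [norm_sub_rev]; exact hu.trans_le (min_le_left _ _),
          by rw [norm_sub_rev]; exact hv.trans_le (min_le_left _ _)⟩)
  have h4 := h2 u' (by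
    rw [dist_eq_norm, norm_sub_rev]; exact hu.trans_le (min_le_right _ _))
  simp only [h, dist_eq_norm] at h3 h4
  have h5 := isUnit_of_near_one h3
  have h6 := isUnit_of_near_one h4
  have h7 : IsUnit ((⟨v', hv'⟩ : D) * ⟨u', hu'⟩) := isUnit_of_isUnit_coe D _ h5
  obtain ⟨k, hk⟩ := h7.exists_left_inv
  rw [← mul_assoc] at hk
  have h8 := isUnit_val_of_leftInv D _ _ hk
  have h9 : IsUnit (⟨u', hu'⟩ : D) := ⟨⟨_, _, h8, hk⟩, rfl⟩
  have h10 : IsUnit u' := h9.map D.val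
  have h11 : IsUnit v := by
    obtain ⟨w, hw⟩ := h10
    have : v = (v * u') * ↑w⁻¹ := by rw [← hw, mul_assoc, Units.mul_inv, mul_one]
    rw [this]
    exact h6.mul (Units.isUnit _)
  obtain ⟨w, hw⟩ := h11
  have : u = ↑w⁻¹ := by
    rw [← hw] at h
    exact (Units.inv_eq_of_mul_eq_one_right h).symm
  rw [this]; exact Units.isUnit _

lemma finite_spec (D : Subalgebra ℂ A) [FiniteDimensional ℂ D] (x : D) :
    (spectrum ℂ (x : A)).Finite := by
  have h1 : spectrum ℂ (x : A) ⊆ spectrum ℂ x := AlgHom.spectrum_apply_subset D.val x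
  refine Set.Finite.subset ?_ h1
  have h2 : spectrum ℂ x ⊆ {μ | (minpoly ℂ x).IsRoot μ} := by
    intro μ hμ
    have := spectrum.subset_polynomial_aeval x (minpoly ℂ x) ⟨μ, hμ, rfl⟩
    rw [minpoly.aeval] at this
    rcases subsingleton_or_nontrivial D with hs | hn
    · exfalso
      exact spectrum.mem_iff.1 hμ (isUnit_of_subsingleton _)
    · rw [spectrum.zero_eq] at this
      exact this
  refine Set.Finite.subset ?_ h2
  exact Polynomial.finite_setOfPred_isRoot (minpoly.ne_zero (IsIntegral.of_finite ℂ x))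

lemma exists_scalar {x : A} (hx : IsUnit x) (hs : (spectrum ℂ x).Finite) :
    ∃ c : ℂ, ∀ t ∈ Set.Icc (0 : ℝ) 1, IsUnit (algebraMap ℂ A c + t • (x - algebraMap ℂ A c)) := by
  have hfin : ((fun s : ℂ => -(s / (‖s‖ : ℂ))) '' spectrum ℂ x).Finite := hs.image _
  have hinf : (Set.range (fun z : Circle => (z : ℂ))).Infinite := by
    have : Infinite (Set.Ioc (-Real.pi) Real.pi) :=
      (Set.Ioc_infinite (by linarith [Real.pi_pos])).to_subtype
    have : Infinite Circle := Infinite.of_injective _ Circle.argEquiv.symm.injective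
    apply Set.infinite_range_of_injective
    exact fun a b h => Circle.ext h
  obtain ⟨c, ⟨z, rfl⟩, hc⟩ := hinf.exists_notMem_finite hfin
  refine ⟨z, fun t ht => ?_⟩
  have hz : ‖(z : ℂ)‖ = 1 := Circle.norm_coe z
  have hz0 : (z : ℂ) ≠ 0 := by intro h; rw [h] at hz; simp at hz
  have e : ∀ y : A, t • y = (t : ℂ) • y := fun y => rfl
  rw [e]
  rcases eq_or_lt_of_le ht.1 with h0 | h0
  · rw [← h0]
    simp only [Complex.ofReal_zero, zero_smul, add_zero]
    exact (isUnit_iff_ne_zero.2 hz0).map (algebraMap ℂ A)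
  have ht0 : (t : ℂ) ≠ 0 := by exact_mod_cast h0.ne'
  by_contra hcon
  set r : ℝ := (1 - t) / t with hr
  have hr0 : 0 ≤ r := div_nonneg (by linarith [ht.2]) h0.le
  have key : algebraMap ℂ A z + (t : ℂ) • (x - algebraMap ℂ A z)
      = (-(t : ℂ)) • (algebraMap ℂ A (-(r * z)) - x) := by
    have e1 : -(t : ℂ) * (-((r : ℂ) * z)) = z - t * z := by
      rw [hr]; push_cast; field_simp
    rw [smul_sub, smul_sub]
    simp only [Algebra.algebraMap_eq_smul_one, smul_smul]
    rw [e1, sub_smul, neg_smul]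
    abel
  have hmem : -(r * (z : ℂ)) ∈ spectrum ℂ x := by
    rw [spectrum.mem_iff]
    intro h
    apply hcon
    rw [key]
    rw [Algebra.smul_def]
    exact ((isUnit_iff_ne_zero.2 (neg_ne_zero.2 ht0)).map (algebraMap ℂ A)).mul h
  have hrpos : r ≠ 0 := by
    intro h
    rw [h] at hmem
    simp only [Complex.ofReal_zero, zero_mul, neg_zero] at hmem
    exact spectrum.zero_notMem ℂ hx hmem
  apply hc
  refine ⟨_, hmem, ?_⟩
  have : (r : ℂ) ≠ 0 := by exact_mod_cast hrpos
  simp only [norm_neg, norm_mul, hz, Complex.norm_real, Real.norm_of_nonneg hr0, mul_one]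
  field_simp
  

open Real in
theorem banach_core [Nontrivial A] (hA : LocFin A) (γ : ℝ → A →ₐ[ℂ] A) (h0 : ∀ x, γ 0 x = x)
    (hadd : ∀ s t x, γ (s + t) x = γ t (γ s x)) (hper : ∀ s x, γ (s + 2 * π) x = γ s x)
    (hcont : ∀ x, Continuous fun θ => γ θ x) (hbd : ∀ θ x, ‖γ θ x‖ ≤ ‖x‖)
    (hdense : ∀ (x : A) (ε : ℝ), 0 < ε →
      ∃ y, ‖x - y‖ < ε ∧ ∃ y', HasDerivAt (fun θ => γ θ y) y' 0)
    (u v : A) (hvu : v * u = 1) (n : ℕ) (hn : 1 ≤ n)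
    (hu : ∀ θ : ℝ, γ θ u = Complex.exp ((n * θ : ℝ) * Complex.I) • u) : False := by
  obtain ⟨τ, h1, hτ, hinv⟩ := exists_inv_trace hA γ hadd hper hcont hbd
  have huu : IsUnit u := hA.isUnit_of_leftInv hvu
  obtain ⟨ε, hε, hball⟩ := Metric.isOpen_iff.1 (Units.isOpen (R := A)) u huu
  obtain ⟨D, hD, hF⟩ := hA {u} ε hε
  obtain ⟨x0, hx0, hux⟩ := hF u (by simp)
  have hx0b : x0 ∈ Metric.ball u ε := by rwa [Metric.mem_ball, dist_comm, dist_eq_norm]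
  have hx0u : IsUnit x0 := hball hx0b
  obtain ⟨c, hc⟩ := exists_scalar hx0u (finite_spec D ⟨x0, hx0⟩)
  have hcontx : Continuous (fun q : ℝ × A =>
    algebraMap ℂ A c + q.1 • (q.2 - algebraMap ℂ A c)) := by fun_prop
  -- the set of good perturbations is open
  have hopen : ∀ᶠ x in nhds x0, ∀ t ∈ Set.Icc (0 : ℝ) 1,
      IsUnit (algebraMap ℂ A c + t • (x - algebraMap ℂ A c)) := by
    apply isCompact_Icc.eventually_forall_of_forall_eventually
    intro t ht
    have : ContinuousAt (fun q : A × ℝ =>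
      algebraMap ℂ A c + q.2 • (q.1 - algebraMap ℂ A c)) (x0, t) := by fun_prop
    exact this.eventually (Units.isOpen.mem_nhds (hc t ht))
  have hopen2 : ∀ᶠ x in nhds x0, x ∈ Metric.ball u ε := Metric.isOpen_ball.mem_nhds hx0b
  obtain ⟨δ, hδ, hgood⟩ := Metric.eventually_nhds_iff.1 (hopen.and hopen2)
  obtain ⟨x1, hx1, x1', hder⟩ := hdense x0 δ hδ
  obtain ⟨g1, g2⟩ := hgood (y := x1) (by rwa [dist_comm, dist_eq_norm])
  have hderc : HasDerivAt (fun θ => γ θ (algebraMap ℂ A c)) 0 0 := by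
    have : (fun θ => γ θ (algebraMap ℂ A c)) = fun _ => algebraMap ℂ A c := by
      funext θ; exact (γ θ).commutes c
    rw [this]; exact hasDerivAt_const _ _
  have hderu : HasDerivAt (fun θ => γ θ u) ((n * Complex.I) • u) 0 := by
    have e1 : (fun θ => γ θ u) = fun θ : ℝ => Complex.exp ((n * θ : ℝ) * Complex.I) • u := by
      funext θ; exact hu θ
    rw [e1]
    have e2 : HasDerivAt (fun θ : ℝ => Complex.exp ((n * θ : ℝ) * Complex.I)) (n * Complex.I) 0 := by
      have a1 : HasDerivAt (fun θ : ℝ => (((n * θ : ℝ) : ℂ)) * Complex.I) (n * Complex.I) 0 := by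
        have := (((hasDerivAt_id (0 : ℝ)).const_mul (n : ℝ)).ofReal_comp).mul_const Complex.I
        simpa using this
      have := a1.cexp
      simpa using this
    exact e2.smul_const u
  have s1 := logder_const γ h0 τ hτ hinv hderc hder g1
  have s2 := logder_const γ h0 τ hτ hinv hderu hder (fun t ht => by
    apply hball
    apply (convex_ball u ε) (Metric.mem_ball_self hε) g2 (a := 1 - t) (b := t)
      (by linarith [ht.2]) ht.1 (by ring) |> fun h => ?_
    convert h using 1
    rw [smul_sub, sub_smul, one_smul]; abel)
  rw [← s1, mul_zero, map_zero] at s2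
  rw [mul_smul_comm, Ring.inverse_mul_cancel _ huu, map_smul, h1] at s2
  simp at s2
  omega

end core3
section quot
variable {C : Type*} [NormedRing C] [NormedAlgebra ℂ C]

/-- The quotient of a normed ring by a closed two-sided ideal. -/
instance quotNormedRing (I : Ideal C) [I.IsTwoSided] [IsClosed (I : Set C)] : NormedRing (C ⧸ I) :=
  { Submodule.Quotient.normedAddCommGroup I, Ideal.Quotient.ring I with
    norm_mul_le := fun x y => by
      refine le_of_forall_pos_le_add fun ε hε => ?_
      have hcont : Filter.Tendsto (fun δ : ℝ => (‖x‖ + δ) * (‖y‖ + δ)) (nhds 0)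
          (nhds (‖x‖ * ‖y‖)) := by
        have : Continuous (fun δ : ℝ => (‖x‖ + δ) * (‖y‖ + δ)) := by fun_prop
        simpa using this.tendsto 0
      have h1 := hcont.eventually (Iio_mem_nhds (show ‖x‖ * ‖y‖ < ‖x‖ * ‖y‖ + ε by linarith))
      obtain ⟨δ, hδ, h2⟩ := Metric.eventually_nhds_iff.1 h1
      have h3 := h2 (y := δ / 2) (by simp [abs_of_pos hδ]; linarith)
      obtain ⟨a, ha, ha'⟩ := Submodule.Quotient.norm_mk_lt (S := I) x (half_pos hδ)
      obtain ⟨b, hb, hb'⟩ := Submodule.Quotient.norm_mk_lt (S := I) y (half_pos hδ)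
      have e : x * y = Ideal.Quotient.mk I (a * b) := by
        rw [map_mul, ← ha, ← hb]; rfl
      rw [e]
      calc ‖(Ideal.Quotient.mk I (a * b) : C ⧸ I)‖ ≤ ‖a * b‖ := Submodule.Quotient.norm_mk_le I _
        _ ≤ ‖a‖ * ‖b‖ := norm_mul_le _ _
        _ ≤ (‖x‖ + δ / 2) * (‖y‖ + δ / 2) := by gcongr
        _ ≤ _ := h3.le }

instance quotNormedAlgebra (I : Ideal C) [I.IsTwoSided] [IsClosed (I : Set C)] :
    NormedAlgebra ℂ (C ⧸ I) :=
  { (Ideal.Quotient.algebra ℂ : Algebra ℂ (C ⧸ I)) with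
    norm_smul_le := fun c x => by
      exact norm_smul_le (α := ℂ) (β := C ⧸ I) c x }

instance quotComplete (I : Ideal C) [I.IsTwoSided] [IsClosed (I : Set C)] [CompleteSpace C] :
    CompleteSpace (C ⧸ I) := Submodule.Quotient.completeSpace I

lemma quot_norm_le (I : Ideal C) [I.IsTwoSided] [IsClosed (I : Set C)] (x : C) :
    ‖Ideal.Quotient.mk I x‖ ≤ ‖x‖ := Submodule.Quotient.norm_mk_le I x

lemma LocFin.quot (I : Ideal C) [I.IsTwoSided] [IsClosed (I : Set C)] (h : LocFin C) :
    LocFin (C ⧸ I) := by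
  classical
  intro F ε hε
  have hs : Function.Surjective (Ideal.Quotient.mk I) := Ideal.Quotient.mk_surjective
  choose g hg using hs
  obtain ⟨D, hD, hF⟩ := h (F.image g) ε hε
  refine ⟨D.map (Ideal.Quotient.mkₐ ℂ I), ?_, ?_⟩
  · have : FiniteDimensional ℂ (Submodule.map (Ideal.Quotient.mkₐ ℂ I).toLinearMap
      (Subalgebra.toSubmodule D)) := by
      have : FiniteDimensional ℂ (Subalgebra.toSubmodule D) := hD
      infer_instance
    exact this
  · intro x hx
    obtain ⟨y, hy, hxy⟩ := hF (g x) (Finset.mem_image_of_mem g hx)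
    refine ⟨Ideal.Quotient.mk I y, ⟨y, hy, rfl⟩, ?_⟩
    rw [← hg x, ← map_sub]
    exact (quot_norm_le I _).trans_lt hxy

end quot

section corner
variable {B : Type*} [NonUnitalCStarAlgebra B]

/-- The corner `pBp`, as a non-unital subalgebra. -/
def cornerSub (p : B) : NonUnitalSubalgebra ℂ B where
  carrier := {x | p * x = x ∧ x * p = x}
  zero_mem' := by simp
  add_mem' := fun {a b} ha hb => ⟨by rw [mul_add, ha.1, hb.1], by rw [add_mul, ha.2, hb.2]⟩
  mul_mem' := fun {a b} ha hb => ⟨by rw [← mul_assoc, ha.1], by rw [mul_assoc, hb.2]⟩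
  smul_mem' := fun c x hx => ⟨by rw [mul_smul_comm, hx.1], by rw [smul_mul_assoc, hx.2]⟩

/-- The corner `pBp`, as a type. -/
def Cor (p : B) (_ : p * p = p) : Type _ := ↥(cornerSub p)

variable {p : B} {hp : p * p = p}

/-- The inclusion of the corner. -/
def Cor.val (x : Cor p hp) : B := Subtype.val x

instance : NonUnitalNormedRing (Cor p hp) := inferInstanceAs (NonUnitalNormedRing ↥(cornerSub p))
lemma Cor.left (x : Cor p hp) : p * x.val = x.val := x.2.1
lemma Cor.right (x : Cor p hp) : x.val * p = x.val := x.2.2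
lemma Cor.ext {x y : Cor p hp} (h : x.val = y.val) : x = y := Subtype.ext h

/-- Constructor for corner elements. -/
def Cor.mk (hp : p * p = p) (x : B) (h1 : p * x = x) (h2 : x * p = x) : Cor p hp := ⟨x, h1, h2⟩

instance : NormedSpace ℂ (Cor p hp) :=
  { (inferInstanceAs (Module ℂ ↥(cornerSub p)) : Module ℂ (Cor p hp)) with
    norm_smul_le := fun c x => norm_smul_le c x.val }

instance : IsScalarTower ℂ (Cor p hp) (Cor p hp) :=
  ⟨fun r x y => Cor.ext (smul_mul_assoc r x.val y.val)⟩
instance : SMulCommClass ℂ (Cor p hp) (Cor p hp) :=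
  ⟨fun r x y => Cor.ext (mul_smul_comm r x.val y.val).symm⟩

instance : NormedRing (Cor p hp) :=
  { (inferInstance : NonUnitalNormedRing (Cor p hp)) with
    one := Cor.mk hp p hp hp
    one_mul := fun x => Cor.ext x.left
    mul_one := fun x => Cor.ext x.right }

instance : NormedAlgebra ℂ (Cor p hp) :=
  { (Algebra.ofModule (fun r x y => smul_mul_assoc r x y) (fun r x y => mul_smul_comm r x y) :
      Algebra ℂ (Cor p hp)) with
    norm_smul_le := fun c x => norm_smul_le c x }

@[simp] lemma Cor.val_one : (1 : Cor p hp).val = p := rfl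
@[simp] lemma Cor.val_zero : (0 : Cor p hp).val = 0 := rfl
@[simp] lemma Cor.val_mul (x y : Cor p hp) : (x * y).val = x.val * y.val := rfl
@[simp] lemma Cor.val_add (x y : Cor p hp) : (x + y).val = x.val + y.val := rfl
@[simp] lemma Cor.val_sub (x y : Cor p hp) : (x - y).val = x.val - y.val := rfl
@[simp] lemma Cor.val_smul (c : ℂ) (x : Cor p hp) : (c • x).val = c • x.val := rfl
@[simp] lemma Cor.val_mk (x : B) (h1 : p * x = x) (h2 : x * p = x) :
    (Cor.mk hp x h1 h2).val = x := rfl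
lemma Cor.norm_def (x : Cor p hp) : ‖x‖ = ‖x.val‖ := rfl

lemma Cor.isometry_val : Isometry (Cor.val : Cor p hp → B) := isometry_subtype_coe

instance : CompleteSpace (Cor p hp) := by
  have : IsClosed (cornerSub p : Set B) := by
    have h1 : IsClosed {x : B | p * x = x} := isClosed_eq (by fun_prop) (by fun_prop)
    have h2 : IsClosed {x : B | x * p = x} := isClosed_eq (by fun_prop) (by fun_prop)
    exact h1.inter h2
  exact this.completeSpace_coe

/-- Compression to the corner. -/
def Cor.comp (hp : p * p = p) (x : B) : Cor p hp :=
  Cor.mk hp (p * x * p) (by simp only [← mul_assoc, hp]) (by simp only [mul_assoc, hp])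

end corner

section lemmaP
variable {B : Type*} [NonUnitalCStarAlgebra B]

/-- A continuous cut-off function. -/
def cutF (t : ℝ) : ℝ := max 0 (min 1 (4 * t - 3 / 2))

lemma cutF_cont : Continuous cutF := by unfold cutF; fun_prop

lemma cutF_zero : cutF 0 = 0 := by unfold cutF; norm_num

lemma cutF_spec {t η : ℝ} (h : |t * t - t| ≤ η) (hη : η ≤ 1 / 16) :
    cutF t * cutF t = cutF t ∧ |cutF t - t| ≤ 2 * η := by
  have h1 := abs_le.1 h
  unfold cutF
  rcases le_total t (1/2) with ht | ht
  · have h2 : t ≤ 3 / 8 := by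
      by_contra hc
      push Not at hc
      nlinarith
    rw [max_eq_left ((min_le_right _ _).trans (by linarith))]
    refine ⟨by ring, ?_⟩
    rw [abs_le]
    constructor <;> nlinarith
  · have h2 : 5 / 8 ≤ t := by
      by_contra hc
      push Not at hc
      nlinarith
    rw [min_eq_left (by linarith), max_eq_right (by norm_num)]
    refine ⟨by ring, ?_⟩
    rw [abs_le]
    constructor <;> nlinarith

lemma norm_proj_le_one {p : B} (hs : star p = p) (hp : p * p = p) : ‖p‖ ≤ 1 := by
  have h : ‖p‖ * ‖p‖ = ‖p‖ := by
    rw [← CStarRing.norm_star_mul_self (x := p), hs, hp]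
  nlinarith [norm_nonneg p]

lemma near_proj {p y : B} (hs : star p = p) (hp : p * p = p) (hy : IsSelfAdjoint y) {δ : ℝ}
    (hδ : δ ≤ 1 / 64) (hpy : ‖y - p‖ ≤ δ) :
    cfcₙ cutF y * cfcₙ cutF y = cfcₙ cutF y ∧ ‖cfcₙ cutF y - p‖ ≤ 9 * δ := by
  have hp1 := norm_proj_le_one hs hp
  have hδ0 : 0 ≤ δ := (norm_nonneg _).trans hpy
  have hy1 : ‖y‖ ≤ 1 + δ := by
    calc ‖y‖ = ‖p + (y - p)‖ := by congr 1; abel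
      _ ≤ ‖p‖ + ‖y - p‖ := norm_add_le _ _
      _ ≤ _ := by linarith
  have hyy : ‖y * y - y‖ ≤ 4 * δ := by
    have e : y * y - y = y * (y - p) + (y - p) * p - (y - p) := by
      rw [mul_sub, sub_mul, hp]; abel
    rw [e]
    calc _ ≤ ‖y * (y - p) + (y - p) * p‖ + ‖y - p‖ := norm_sub_le _ _
      _ ≤ ‖y * (y - p)‖ + ‖(y - p) * p‖ + ‖y - p‖ := by gcongr; exact norm_add_le _ _
      _ ≤ ‖y‖ * ‖y - p‖ + ‖y - p‖ * ‖p‖ + ‖y - p‖ := by gcongr <;> exact norm_mul_le _ _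
      _ ≤ (1 + δ) * δ + δ * 1 + δ := by gcongr
      _ ≤ 4 * δ := by nlinarith
  have e2 : cfcₙ (fun t : ℝ => t * t - t) y = y * y - y := by
    rw [cfcₙ_sub (fun t : ℝ => t * t) (fun t => t) y, cfcₙ_mul (fun t : ℝ => t) (fun t => t) y,
      cfcₙ_id' ℝ y]
  have hq : ∀ t ∈ quasispectrum ℝ y, |t * t - t| ≤ 4 * δ := by
    intro t ht
    have := norm_apply_le_norm_cfcₙ (fun t : ℝ => t * t - t) y ht
    rw [e2] at this
    exact this.trans hyy
  constructor
  · rw [← cfcₙ_mul cutF cutF y cutF_cont.continuousOn cutF_zero cutF_cont.continuousOn cutF_zero]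
    exact cfcₙ_congr fun t ht => (cutF_spec (hq t ht) (by linarith)).1
  · have e3 : cfcₙ (fun t : ℝ => cutF t - t) y = cfcₙ cutF y - y := by
      rw [cfcₙ_sub cutF (fun t => t) y cutF_cont.continuousOn cutF_zero, cfcₙ_id' ℝ y]
    have h4 : ‖cfcₙ cutF y - y‖ ≤ 8 * δ := by
      rw [← e3]
      refine norm_cfcₙ_le fun t ht => ?_
      have := (cutF_spec (hq t ht) (by linarith)).2
      rw [Real.norm_eq_abs]; linarith
    calc ‖cfcₙ cutF y - p‖ = ‖(cfcₙ cutF y - y) + (y - p)‖ := by congr 1; abel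
      _ ≤ _ := norm_add_le _ _
      _ ≤ _ := by linarith

lemma AF_proj (hAF : IsAFAlgebra B) {p : B} (hs : star p = p) (hp : p * p = p) (F : Finset B)
    {ε : ℝ} (hε : 0 < ε) :
    ∃ D : NonUnitalStarSubalgebra ℂ B, FiniteDimensional ℂ D ∧ (∃ e ∈ D, e * e = e ∧ ‖e - p‖ < ε) ∧
      ∀ x ∈ F, ∃ y ∈ D, ‖x - y‖ < ε := by
  classical
  set δ : ℝ := min (ε / 16) (1 / 64) with hδ
  have hδ0 : 0 < δ := lt_min (by linarith) (by norm_num)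
  have hδ1 : δ ≤ ε / 16 := min_le_left _ _
  have hδ2 : δ ≤ 1 / 64 := min_le_right _ _
  obtain ⟨D, hD, hF⟩ := hAF (insert p F) δ hδ0
  refine ⟨D, hD, ?_, ?_⟩
  · obtain ⟨y₀, hy₀, hpy⟩ := hF p (by simp)
    have hy₀' : y₀ ∈ D := hy₀
    set y : B := (1 / 2 : ℂ) • (y₀ + star y₀) with hy
    have hyD : y ∈ D := SMulMemClass.smul_mem _ (add_mem hy₀' (star_mem hy₀'))
    have hysa : IsSelfAdjoint y := by
      rw [IsSelfAdjoint, hy, star_smul, star_add, star_star, add_comm]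
      simp
    have hn : ‖y - p‖ ≤ δ := by
      have e : y - p = (1 / 2 : ℂ) • ((y₀ - p) + star (y₀ - p)) := by
        rw [hy, star_sub, hs]
        have : p = (1 / 2 : ℂ) • (p + p) := by
          rw [← two_smul ℂ p, smul_smul]; norm_num
        nth_rewrite 1 [this]
        rw [← smul_sub]; congr 1; abel
      rw [e, norm_smul]
      have h1 : ‖(y₀ - p) + star (y₀ - p)‖ ≤ ‖y₀ - p‖ + ‖y₀ - p‖ := by
        refine (norm_add_le _ _).trans ?_
        rw [norm_star]
      rw [norm_sub_rev] at hpy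
      have : ‖(1 / 2 : ℂ)‖ = 1 / 2 := by norm_num
      rw [this]; linarith
    obtain ⟨h1, h2⟩ := near_proj hs hp hysa hδ2 hn
    have hcl : IsClosed (D : Set B) := by
      have : FiniteDimensional ℂ D.toSubmodule := hD
      exact D.toSubmodule.closed_of_finiteDimensional
    exact ⟨_, cfcₙ_mem (𝕜' := ℂ) (hs := hcl) cutF hyD, h1, by linarith⟩
  · intro x hx
    obtain ⟨y, hy, h⟩ := hF x (by simp [hx])
    exact ⟨y, hy, by linarith⟩

end lemmaP

section lemmaQ
variable {B : Type*} [NonUnitalCStarAlgebra B] {p : B} {hp : p * p = p}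

lemma idem_zero {f : B} (hf : f * f = f) (h : ‖f‖ < 1) : f = 0 := by
  have h1 : ‖f‖ ≤ ‖f‖ * ‖f‖ := by
    nth_rewrite 1 [← hf]; exact norm_mul_le _ _
  have : ‖f‖ = 0 := by nlinarith [norm_nonneg f]
  exact norm_eq_zero.1 this

lemma Cor.val_comp (x : B) : (Cor.comp hp x).val = p * x * p := rfl

lemma Cor.norm_comp_le (hs : star p = p) (x : B) : ‖Cor.comp hp x‖ ≤ ‖x‖ := by
  rw [Cor.norm_def, Cor.val_comp]
  have h1 := norm_proj_le_one hs hp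
  calc ‖p * x * p‖ ≤ ‖p‖ * ‖x‖ * ‖p‖ := norm_mul₃_le
    _ ≤ 1 * ‖x‖ * 1 := by gcongr
    _ = ‖x‖ := by ring

lemma Cor.comp_val (x : Cor p hp) : Cor.comp hp x.val = x :=
  Cor.ext (by rw [Cor.val_comp, x.left, x.right])

lemma Cor.comp_add (x y : B) : Cor.comp hp (x + y) = Cor.comp hp x + Cor.comp hp y :=
  Cor.ext (by simp [Cor.val_comp, mul_add, add_mul])

lemma Cor.comp_sub (x y : B) : Cor.comp hp (x - y) = Cor.comp hp x - Cor.comp hp y :=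
  Cor.ext (by simp [Cor.val_comp, mul_sub, sub_mul])

lemma Cor.comp_smul (c : ℂ) (x : B) : Cor.comp hp (c • x) = c • Cor.comp hp x :=
  Cor.ext (by rw [Cor.val_smul, Cor.val_comp, Cor.val_comp, mul_smul_comm, smul_mul_assoc])

lemma Cor.comp_p : Cor.comp hp p = 1 := Cor.ext (by simp [Cor.val_comp, hp])

/-- compression as a linear map -/
def Cor.compL (hp : p * p = p) : B →ₗ[ℂ] Cor p hp where
  toFun := Cor.comp hp
  map_add' := Cor.comp_add
  map_smul' := Cor.comp_smul

lemma corner_step (hs : star p = p) (D : NonUnitalStarSubalgebra ℂ B) [FiniteDimensional ℂ D]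
    {e : B} (heD : e ∈ D) (he : e * e = e) {δ : ℝ} (hδ : δ ≤ 1 / 8) (hep : ‖e - p‖ ≤ δ) :
    ∃ D' : Subalgebra ℂ (Cor p hp), FiniteDimensional ℂ D' ∧
      ∀ (x : Cor p hp) (d : B), d ∈ D → ‖x.val - d‖ ≤ δ →
        ∃ y ∈ D', ‖x - y‖ ≤ 9 * (‖x‖ + 1) * δ := by
  have hp1 := norm_proj_le_one hs hp
  have hδ0 : 0 ≤ δ := (norm_nonneg _).trans hep
  have h11 : ‖(1 : Cor p hp)‖ ≤ 1 := hp1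
  have he1 : ‖e‖ ≤ 9 / 8 := by
    calc ‖e‖ = ‖p + (e - p)‖ := by congr 1; abel
      _ ≤ ‖p‖ + ‖e - p‖ := norm_add_le _ _
      _ ≤ _ := by linarith
  set h : Cor p hp := Cor.comp hp e with hh
  have hh1 : ‖h - 1‖ ≤ δ := by
    rw [hh, ← Cor.comp_p, ← Cor.comp_sub]
    exact (Cor.norm_comp_le hs _).trans hep
  obtain ⟨U, hU⟩ := isUnit_of_near_one (x := h) (by linarith)
  set k : Cor p hp := ↑U⁻¹ with hk
  have hhk : h * k = 1 := by rw [← hU, hk]; exact U.mul_inv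
  have hkh : k * h = 1 := by rw [← hU, hk]; exact U.inv_mul
  have hk1 : 1 - k = k * (h - 1) := by rw [mul_sub, hkh, mul_one]
  have hkd : ‖1 - k‖ ≤ ‖k‖ * δ := by
    rw [hk1]; exact (norm_mul_le _ _).trans (by gcongr)
  have hkn : ‖k‖ ≤ 8 / 7 := by
    have : ‖k‖ ≤ ‖(1 : Cor p hp)‖ + ‖1 - k‖ := by
      calc ‖k‖ = ‖1 - (1 - k)‖ := by congr 1; abel
        _ ≤ _ := norm_sub_le _ _
    nlinarith [norm_nonneg k]
  have hkd2 : ‖1 - k‖ ≤ 8 / 7 * δ := hkd.trans (by gcongr)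
  -- the key identity
  have hkek : k.val * e * k.val = k.val := by
    have h1 : k * h * k = k := by rw [hkh, one_mul]
    have h2 := congrArg Cor.val h1
    rw [Cor.val_mul, Cor.val_mul, hh, Cor.val_comp] at h2
    calc k.val * e * k.val = (k.val * p) * e * (p * k.val) := by rw [k.left, k.right]
      _ = k.val * (p * e * p) * k.val := by simp only [mul_assoc]
      _ = _ := h2
  have heke : e * k.val * e = e := by
    have hidem : (e - e * k.val * e) * (e - e * k.val * e) = e - e * k.val * e := by
      have e1 : e * (e * k.val * e) = e * k.val * e := by simp only [← mul_assoc, he]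
      have e2 : (e * k.val * e) * e = e * k.val * e := by simp only [mul_assoc, he]
      have e3 : (e * k.val * e) * (e * k.val * e) = e * k.val * e := by
        calc (e * k.val * e) * (e * k.val * e) = e * (k.val * (e * e) * k.val) * e := by
              simp only [mul_assoc]
          _ = _ := by rw [he, hkek]
      rw [sub_mul, mul_sub, mul_sub, e1, e2, e3, he]; abel
    have hnorm : ‖e - e * k.val * e‖ < 1 := by
      have e4 : e - e * k.val * e = e * (e - p) * e + e * (1 - k).val * e := by
        rw [Cor.val_sub, Cor.val_one]
        simp only [mul_sub, sub_mul, he]; abel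
      rw [e4]
      have hkd3 : ‖(1 - k).val‖ ≤ 8 / 7 * δ := hkd2
      calc _ ≤ ‖e * (e - p) * e‖ + ‖e * (1 - k).val * e‖ := norm_add_le _ _
        _ ≤ ‖e‖ * ‖e - p‖ * ‖e‖ + ‖e‖ * ‖(1 - k).val‖ * ‖e‖ := by
            gcongr <;> exact norm_mul₃_le
        _ ≤ 9 / 8 * (1 / 8) * (9 / 8) + 9 / 8 * (8 / 7 * (1 / 8)) * (9 / 8) := by
            gcongr
            · linarith
            · linarith
        _ < 1 := by norm_num
    exact (sub_eq_zero.1 (idem_zero hidem hnorm)).symm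
  let φ : B →ₗ[ℂ] Cor p hp :=
    (LinearMap.mulRight ℂ k) ∘ₗ (Cor.compL hp) ∘ₗ (LinearMap.mulLeft ℂ e) ∘ₗ
      (LinearMap.mulRight ℂ e)
  have hφ : ∀ d, φ d = Cor.comp hp (e * (d * e)) * k := fun d => rfl
  have hφv : ∀ d, (φ d).val = p * (e * d * e) * k.val := fun d => by
    rw [hφ, Cor.val_mul, Cor.val_comp, mul_assoc _ p, k.left, mul_assoc e]
  have hφmul : ∀ d d', φ d * φ d' = φ (d * e * d') := fun d d' => Cor.ext (by
    rw [Cor.val_mul, hφv, hφv, hφv]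
    calc p * (e * d * e) * k.val * (p * (e * d' * e) * k.val)
        = p * (e * d) * (e * (k.val * p) * e) * d' * e * k.val := by simp only [mul_assoc]
      _ = _ := by rw [k.right, heke]; simp only [mul_assoc])
  have hφe : φ e = 1 := by
    rw [hφ, he, he]; exact hhk
  let D' : Subalgebra ℂ (Cor p hp) :=
    { carrier := {c | ∃ d ∈ D, φ d = c}
      mul_mem' := by
        rintro _ _ ⟨d, hd, rfl⟩ ⟨d', hd', rfl⟩
        exact ⟨d * e * d', mul_mem (mul_mem hd heD) hd', (hφmul d d').symm⟩
      add_mem' := by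
        rintro _ _ ⟨d, hd, rfl⟩ ⟨d', hd', rfl⟩
        exact ⟨d + d', add_mem hd hd', map_add _ _ _⟩
      algebraMap_mem' := fun r =>
        ⟨r • e, SMulMemClass.smul_mem r heD, by
          rw [map_smul, hφe, Algebra.algebraMap_eq_smul_one]⟩ }
  refine ⟨D', ?_, ?_⟩
  · have h1 : FiniteDimensional ℂ D.toSubmodule := ‹FiniteDimensional ℂ D›
    have h2 : FiniteDimensional ℂ (Submodule.map φ D.toSubmodule) := inferInstance
    exact h2
  · intro x d hd hxd
    refine ⟨φ d, ⟨d, hd, rfl⟩, ?_⟩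
    have hx : ‖x.val‖ = ‖x‖ := rfl
    set w := Cor.comp hp (e * (d * e)) with hw
    have e5 : x - φ d = (x - w) + w * (1 - k) := by
      rw [hφ, mul_sub, mul_one]; abel
    have hdn : ‖d‖ ≤ ‖x‖ + 1 := by
      calc ‖d‖ = ‖x.val - (x.val - d)‖ := by congr 1; abel
        _ ≤ ‖x.val‖ + ‖x.val - d‖ := norm_sub_le _ _
        _ ≤ _ := by rw [hx]; linarith
    have hwn : ‖w‖ ≤ 2 * (‖x‖ + 1) := by
      calc ‖w‖ ≤ ‖e * (d * e)‖ := Cor.norm_comp_le hs _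
        _ = ‖e * d * e‖ := by rw [mul_assoc]
        _ ≤ ‖e‖ * ‖d‖ * ‖e‖ := norm_mul₃_le
        _ ≤ 9 / 8 * (‖x‖ + 1) * (9 / 8) := by gcongr
        _ ≤ _ := by nlinarith [norm_nonneg x]
    have hxw : ‖x - w‖ ≤ 5 * (‖x‖ + 1) * δ := by
      have e6 : x - w = Cor.comp hp (x.val - e * (d * e)) := by
        rw [Cor.comp_sub, Cor.comp_val]
      have e7 : x.val - e * (d * e) = (p - e) * x.val + e * x.val * (p - e)
          + e * (x.val - d) * e := by
        have h1 : p * x.val = x.val := x.left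
        have h2 : e * x.val * p = e * x.val := by rw [mul_assoc, x.right]
        simp only [mul_sub, sub_mul, h1, h2, ← mul_assoc]; abel
      rw [e6, e7]
      refine (Cor.norm_comp_le hs _).trans ?_
      rw [norm_sub_rev] at hep
      calc _ ≤ ‖(p - e) * x.val‖ + ‖e * x.val * (p - e)‖ + ‖e * (x.val - d) * e‖ := norm_add₃_le
        _ ≤ ‖p - e‖ * ‖x.val‖ + ‖e‖ * ‖x.val‖ * ‖p - e‖ + ‖e‖ * ‖x.val - d‖ * ‖e‖ := by
            gcongr
            · exact norm_mul_le _ _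
            · exact norm_mul₃_le
            · exact norm_mul₃_le
        _ ≤ δ * ‖x‖ + 9 / 8 * ‖x‖ * δ + 9 / 8 * δ * (9 / 8) := by
            rw [hx]; gcongr
        _ ≤ _ := by nlinarith [norm_nonneg x, mul_nonneg (norm_nonneg x) hδ0]
    rw [e5]
    calc _ ≤ ‖x - w‖ + ‖w * (1 - k)‖ := norm_add_le _ _
      _ ≤ ‖x - w‖ + ‖w‖ * ‖1 - k‖ := by gcongr; exact norm_mul_le _ _
      _ ≤ 5 * (‖x‖ + 1) * δ + 2 * (‖x‖ + 1) * (8 / 7 * δ) := by gcongr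
      _ ≤ _ := by nlinarith [norm_nonneg x, mul_nonneg (norm_nonneg x) hδ0]

lemma LocFin.corner (hAF : IsAFAlgebra B) (hs : star p = p) : LocFin (Cor p hp) := by
  classical
  intro F ε hε
  set M : ℝ := ∑ x ∈ F, ‖x‖ with hM
  have hM0 : 0 ≤ M := Finset.sum_nonneg fun x _ => norm_nonneg x
  set δ : ℝ := min (ε / (9 * (M + 1) + 1)) (1 / 8) with hδ
  have hpos : 0 < 9 * (M + 1) + 1 := by linarith
  have hδ0 : 0 < δ := lt_min (div_pos hε hpos) (by norm_num)
  obtain ⟨D, hD, ⟨e, heD, he, hep⟩, hF⟩ := AF_proj hAF hs hp (F.image Cor.val) hδ0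
  obtain ⟨D', hD', h⟩ := corner_step (hp := hp) hs D heD he (min_le_right _ _) hep.le
  refine ⟨D', hD', fun x hx => ?_⟩
  obtain ⟨d, hd, hxd⟩ := hF x.val (Finset.mem_image_of_mem _ hx)
  obtain ⟨y, hy, hxy⟩ := h x d hd hxd.le
  refine ⟨y, hy, hxy.trans_lt ?_⟩
  have hxM : ‖x‖ ≤ M := Finset.single_le_sum (f := fun x => ‖x‖) (fun x _ => norm_nonneg x) hx
  have h1 : δ * (9 * (M + 1) + 1) ≤ ε := by
    rw [← le_div_iff₀ hpos]; exact min_le_left _ _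
  have h2 : 9 * (‖x‖ + 1) * δ ≤ 9 * (M + 1) * δ := by gcongr
  nlinarith

end lemmaQ

section cstarcore
open Real
variable {B : Type*} [NonUnitalCStarAlgebra B]

lemma closedIdealGen_ideal (q : B) : IsClosedTwoSidedIdealSet B (closedIdealGen B q) := by
  refine ⟨isClosed_sInter fun I hI => hI.1.1, fun I hI => hI.1.2.1, ?_, ?_, ?_⟩
  · exact fun x hx y hy I hI => hI.1.2.2.1 x (hx I hI) y (hy I hI)
  · exact fun c x hx I hI => hI.1.2.2.2.1 c x (hx I hI)
  · exact fun x hx y => ⟨fun I hI => (hI.1.2.2.2.2 x (hx I hI) y).1,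
      fun I hI => (hI.1.2.2.2.2 x (hx I hI) y).2⟩

lemma mem_closedIdealGen (q : B) : q ∈ closedIdealGen B q := fun _ hI => hI.2

lemma norm_map_equiv (g : B ≃⋆ₐ[ℂ] B) (x : B) : ‖g x‖ = ‖x‖ :=
  NonUnitalStarAlgHom.norm_map g (EquivLike.injective g) x

lemma closedIdealGen_inv {q : B} (g : B ≃⋆ₐ[ℂ] B) (hq : g q = q) {x : B}
    (hx : x ∈ closedIdealGen B q) : g x ∈ closedIdealGen B q := by
  intro I hI
  have hcont : Continuous g :=
    (AddMonoidHomClass.isometry_of_norm g (norm_map_equiv g)).continuous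
  have : IsClosedTwoSidedIdealSet B (g ⁻¹' I) ∧ q ∈ g ⁻¹' I := by
    obtain ⟨⟨h1, h2, h3, h4, h5⟩, h6⟩ := hI
    refine ⟨⟨h1.preimage hcont, ?_, ?_, ?_, ?_⟩, ?_⟩
    · simpa using h2
    · intro x hx y hy
      simpa using h3 _ hx _ hy
    · intro c x hx
      simpa using h4 c _ hx
    · intro x hx y
      simpa using h5 _ hx (g y)
    · simpa [hq] using h6
  exact hx _ this

variable {p : B} {hp : p * p = p}

/-- The ideal of the corner cut out by the closed ideal generated by `q`. -/
def corIdeal (hp : p * p = p) (q : B) : Ideal (Cor p hp) where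
  carrier := {x | x.val ∈ closedIdealGen B q}
  zero_mem' := (closedIdealGen_ideal q).2.1
  add_mem' := fun ha hb => (closedIdealGen_ideal q).2.2.1 _ ha _ hb
  smul_mem' := fun c _ hx => ((closedIdealGen_ideal q).2.2.2.2 _ hx c.val).2

lemma mem_corIdeal {q : B} {x : Cor p hp} : x ∈ corIdeal hp q ↔ x.val ∈ closedIdealGen B q :=
  Iff.rfl

instance (q : B) : (corIdeal hp q).IsTwoSided :=
  ⟨fun b ha => ((closedIdealGen_ideal q).2.2.2.2 _ ha b.val).1⟩

instance (q : B) : IsClosed (corIdeal hp q : Set (Cor p hp)) :=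
  (closedIdealGen_ideal q).1.preimage Cor.isometry_val.continuous

/-- A star automorphism fixing `p` acts on the corner. -/
def corMap (hp : p * p = p) (g : B ≃⋆ₐ[ℂ] B) (hg : g p = p) : Cor p hp →ₐ[ℂ] Cor p hp :=
  AlgHom.ofLinearMap
    { toFun := fun x => Cor.mk hp (g x.val) (by
        have h := congrArg g x.left
        rwa [map_mul, hg] at h)
        (by
        have h := congrArg g x.right
        rwa [map_mul, hg] at h)
      map_add' := fun x y => Cor.ext (map_add g _ _)
      map_smul' := fun c x => Cor.ext (map_smul g c x.val) }
    (Cor.ext hg) (fun x y => Cor.ext (map_mul g _ _))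

lemma corMap_val (g : B ≃⋆ₐ[ℂ] B) (hg : g p = p) (x : Cor p hp) :
    (corMap hp g hg x).val = g x.val := rfl

lemma corMap_norm (g : B ≃⋆ₐ[ℂ] B) (hg : g p = p) (x : Cor p hp) :
    ‖corMap hp g hg x‖ = ‖x‖ := norm_map_equiv g x.val

/-- The induced map on the quotient of the corner. -/
def quoMap (hp : p * p = p) (q : B) (g : B ≃⋆ₐ[ℂ] B) (hg : g p = p) (hq : g q = q) :
    (Cor p hp ⧸ corIdeal hp q) →ₐ[ℂ] (Cor p hp ⧸ corIdeal hp q) :=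
  Ideal.quotientMapₐ (corIdeal hp q) (corMap hp g hg)
    (fun x hx => closedIdealGen_inv g hq (x := x.val) hx)

lemma quoMap_mk (q : B) (g : B ≃⋆ₐ[ℂ] B) (hg : g p = p) (hq : g q = q) (x : Cor p hp) :
    quoMap hp q g hg hq (Ideal.Quotient.mk _ x) = Ideal.Quotient.mk _ (corMap hp g hg x) := rfl

/-- The composite of compression and quotient map. -/
def quoComp (hp : p * p = p) (hs : star p = p) (q : B) : B →L[ℂ] (Cor p hp ⧸ corIdeal hp q) :=
  LinearMap.mkContinuous ((Ideal.Quotient.mkₐ ℂ (corIdeal hp q)).toLinearMap ∘ₗ Cor.compL hp) 1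
    (fun x => by
      rw [one_mul]
      exact (quot_norm_le (corIdeal hp q) (Cor.comp hp x)).trans (Cor.norm_comp_le hs x))

lemma quoComp_apply (hs : star p = p) (q : B) (x : B) :
    quoComp hp hs q x = Ideal.Quotient.mk _ (Cor.comp hp x) := rfl

lemma corMap_comp (g : B ≃⋆ₐ[ℂ] B) (hg : g p = p) (x : B) :
    corMap hp g hg (Cor.comp hp x) = Cor.comp hp (g x) :=
  Cor.ext (by rw [corMap_val, Cor.val_comp, Cor.val_comp, map_mul, map_mul, hg])

theorem cstar_core (hAF : IsAFAlgebra B) {p q s : B} (hs : star p = p) (hp : p * p = p)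
    (γ : Circle → B ≃⋆ₐ[ℂ] B) (γ_mul : ∀ z w : Circle, γ (z * w) = (γ w).trans (γ z))
    (γ_cont : ∀ x : B, Continuous fun z => γ z x)
    (hγp : ∀ z, γ z p = p) (hγq : ∀ z, γ z q = q)
    (hdense : ∀ (x : B) (ε : ℝ), 0 < ε → ∃ y, ‖x - y‖ < ε ∧
      ∃ y', HasDerivAt (fun θ : ℝ => γ (Circle.exp θ) y) y' 0)
    (n : ℕ) (hn : 1 ≤ n) (hγs : ∀ z : Circle, γ z s = (z : ℂ) ^ n • s)
    (hrel : (p * star s * p) * (p * s * p) = p - q)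
    (hpI : p ∉ closedIdealGen B q) : False := by
  set K := corIdeal hp q with hK
  have hnt : Nontrivial (Cor p hp ⧸ K) := by
    rw [Ideal.Quotient.nontrivial_iff]
    intro h
    have : (1 : Cor p hp) ∈ K := by rw [h]; trivial
    exact hpI this
  have hLF : LocFin (Cor p hp ⧸ K) := LocFin.quot K (LocFin.corner hAF hs)
  have hγ1 : ∀ x, γ 1 x = x := by
    intro x
    have h1 := γ_mul 1 1
    have h2 := congrArg (fun g : B ≃⋆ₐ[ℂ] B => g x) h1
    simp only [one_mul, StarAlgEquiv.trans_apply] at h2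
    exact ((EquivLike.injective (γ 1)) h2).symm
  have hsurj : Function.Surjective (quoComp hp hs q) := by
    intro x
    obtain ⟨y, rfl⟩ := Ideal.Quotient.mk_surjective x
    exact ⟨y.val, by rw [quoComp_apply, Cor.comp_val]⟩
  let Γ : ℝ → (Cor p hp ⧸ K) →ₐ[ℂ] (Cor p hp ⧸ K) := fun θ =>
    quoMap hp q (γ (Circle.exp θ)) (hγp _) (hγq _)
  have hΓ : ∀ θ x, Γ θ (quoComp hp hs q x) = quoComp hp hs q (γ (Circle.exp θ) x) := by
    intro θ x
    rw [quoComp_apply, quoComp_apply, ← corMap_comp _ (hγp _)]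
    exact quoMap_mk _ _ _ _ _
  refine banach_core hLF Γ ?_ ?_ ?_ ?_ ?_ ?_ (quoComp hp hs q s) (quoComp hp hs q (star s)) ?_ n hn ?_
  · intro x
    obtain ⟨x, rfl⟩ := hsurj x
    rw [hΓ, Circle.exp_zero, hγ1]
  · intro a b x
    obtain ⟨x, rfl⟩ := hsurj x
    rw [hΓ, hΓ, hΓ, add_comm, Circle.exp_add, γ_mul]
    rfl
  · intro a x
    obtain ⟨x, rfl⟩ := hsurj x
    rw [hΓ, hΓ, Circle.periodic_exp]
  · intro x
    obtain ⟨x, rfl⟩ := hsurj x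
    simp only [hΓ]
    exact (quoComp hp hs q).continuous.comp ((γ_cont x).comp Circle.exp.continuous)
  · intro θ x
    refine le_of_forall_pos_lt_add fun ε hε => ?_
    obtain ⟨y, hy, hy'⟩ := Submodule.Quotient.norm_mk_lt (S := K) x hε
    have e : x = Ideal.Quotient.mk K y := hy.symm
    have e2 : Γ θ x = Ideal.Quotient.mk K (corMap hp (γ (Circle.exp θ)) (hγp _) y) := by
      rw [e]; exact quoMap_mk _ _ _ _ _
    rw [e2]
    refine (quot_norm_le K _).trans_lt ?_
    rw [corMap_norm]; exact hy'
  · intro x ε hε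
    obtain ⟨x, rfl⟩ := hsurj x
    obtain ⟨y, hy, y', hy'⟩ := hdense x ε hε
    refine ⟨quoComp hp hs q y, ?_, quoComp hp hs q y', ?_⟩
    · rw [← map_sub]
      refine lt_of_le_of_lt ?_ hy
      exact (quot_norm_le K _).trans (Cor.norm_comp_le hs _)
    · simp only [hΓ]
      exact ((quoComp hp hs q).restrictScalars ℝ).hasFDerivAt.comp_hasDerivAt (0 : ℝ) hy'
  · rw [quoComp_apply, quoComp_apply, ← map_mul, ← map_one (Ideal.Quotient.mk _), eq_comm,
      Ideal.Quotient.mk_eq_mk_iff_sub_mem, mem_corIdeal]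
    rw [Cor.val_sub, Cor.val_mul, Cor.val_comp, Cor.val_comp, hrel, Cor.val_one, sub_sub_cancel]
    exact mem_closedIdealGen q
  · intro θ
    rw [hΓ, hγs, map_smul, Circle.coe_exp, ← Complex.exp_nat_mul]
    congr 2
    push_cast; ring

end cstarcore

section graphpart
variable {G : DirGraph V E} {L : E → 𝒜}

lemma relRng_append (A : Set V) {w₁ w₂ : List 𝒜} (h₁ : w₁ ≠ []) (h₂ : w₂ ≠ []) :
    relRng G L (relRng G L A w₁) w₂ = relRng G L A (w₁ ++ w₂) := by
  ext v
  constructor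
  · rintro ⟨⟨l₂, n₂, c₂⟩, hl₂, ⟨⟨l₁, n₁, c₁⟩, hl₁, hs₁, hr₁⟩, hr₂⟩
    refine ⟨⟨l₁ ++ l₂, by simp [n₁], ?_⟩, ?_, ?_, ?_⟩
    · refine List.isChain_append.2 ⟨c₁, c₂, ?_⟩
      intro x hx y hy
      rw [List.getLast?_eq_getLast_of_ne_nil n₁] at hx
      rw [List.head?_eq_some_head n₂] at hy
      cases hx
      cases hy
      exact hr₁
    · simp only [GPath.label] at hl₁ hl₂ ⊢
      rw [List.map_append, hl₁, hl₂]
    · simp only [GPath.source] at hs₁ ⊢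
      rwa [List.head_append_of_ne_nil n₁]
    · simp only [GPath.range] at hr₂ ⊢
      rwa [List.getLast_append_of_ne_nil _ n₂]
  · rintro ⟨⟨l, n, c⟩, hl, hs, hr⟩
    simp only [GPath.label] at hl
    obtain ⟨l₁, l₂, rfl, hl₁, hl₂⟩ := List.map_eq_append_iff.1 hl
    have n₁ : l₁ ≠ [] := by rintro rfl; exact h₁ hl₁.symm
    have n₂ : l₂ ≠ [] := by rintro rfl; exact h₂ hl₂.symm
    obtain ⟨c₁, c₂, c₃⟩ := List.isChain_append.1 c
    refine ⟨⟨l₂, n₂, c₂⟩, hl₂, ⟨⟨l₁, n₁, c₁⟩, hl₁, ?_, ?_⟩, ?_⟩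
    · simp only [GPath.source] at hs ⊢
      rwa [List.head_append_of_ne_nil n₁] at hs
    · exact c₃ _ (by rw [List.getLast?_eq_getLast_of_ne_nil n₁]; rfl) _
        (by rw [List.head?_eq_some_head n₂]; rfl)
    · simp only [GPath.range] at hr ⊢
      rwa [List.getLast_append_of_ne_nil _ n₂] at hr

lemma rngW_eq_relRng (w : List 𝒜) : rngW G L w = relRng G L Set.univ w := by
  ext v; simp [rngW, relRng]

lemma rngW_append {w₁ w₂ : List 𝒜} (h₁ : w₁ ≠ []) (h₂ : w₂ ≠ []) :
    rngW G L (w₁ ++ w₂) = relRng G L (rngW G L w₁) w₂ := by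
  rw [rngW_eq_relRng, rngW_eq_relRng, relRng_append _ h₁ h₂]

lemma relRng_subset (A : Set V) (w : List 𝒜) : relRng G L A w ⊆ rngW G L w :=
  fun _ ⟨p, h1, _, h3⟩ => ⟨p, h1, h3⟩

lemma IsLabelWord.ne_nil {w : List 𝒜} (h : IsLabelWord G L w) : w ≠ [] := by
  obtain ⟨p, rfl⟩ := h
  simpa [GPath.label] using p.ne

lemma isLabelWord_single (hL : Function.Surjective L) (a : 𝒜) : IsLabelWord G L [a] := by
  obtain ⟨e, rfl⟩ := hL a
  exact ⟨⟨[e], by simp, List.isChain_singleton _⟩, rfl⟩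

lemma IsLabelWord.tail {a b : 𝒜} {w : List 𝒜} (h : IsLabelWord G L (a :: b :: w)) :
    IsLabelWord G L (b :: w) := by
  obtain ⟨⟨l, n, c⟩, hl⟩ := h
  simp only [GPath.label] at hl
  obtain ⟨l₁, l₂, rfl, hl₁, hl₂⟩ := List.map_eq_append_iff.1
    (show List.map L l = [a] ++ (b :: w) from hl)
  have n₂ : l₂ ≠ [] := by rintro rfl; simp at hl₂
  exact ⟨⟨l₂, n₂, (List.isChain_append.1 c).2.1⟩, hl₂⟩

lemma p_sWord {B : Type*} [NonUnitalRing B] [StarRing B] (hL : Function.Surjective L)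
    (rep : LRep G L B) : ∀ (w : List 𝒜), IsLabelWord G L w → ∀ A : Set V, Bbar G L A →
      rep.p A * sWord rep.s w = sWord rep.s w * rep.p (relRng G L A w)
  | [], hw, _, _ => absurd rfl hw.ne_nil
  | [a], _, A, hA => rep.p_s A a hA
  | a :: b :: w, hw, A, hA => by
    have ih := p_sWord hL rep (b :: w) hw.tail (relRng G L A [a])
      (Bbar.rel A [a] hA (isLabelWord_single hL a))
    have e := relRng_append (G := G) (L := L) A (w₁ := [a]) (w₂ := b :: w) (by simp) (by simp)
    rw [e] at ih
    simp only [sWord]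
    rw [← mul_assoc, rep.p_s A a hA, mul_assoc, ih, mul_assoc]
    rfl

lemma star_sWord {B : Type*} [NonUnitalRing B] [StarRing B] (hL : Function.Surjective L)
    (rep : LRep G L B) : ∀ (w : List 𝒜), IsLabelWord G L w →
      star (sWord rep.s w) * sWord rep.s w = rep.p (rngW G L w)
  | [], hw => absurd rfl hw.ne_nil
  | [a], _ => rep.s_s a
  | a :: b :: w, hw => by
    have ih := star_sWord hL rep (b :: w) hw.tail
    have ha : Bbar G L (rngW G L [a]) := Bbar.base _ (isLabelWord_single hL a)
    have h2 := p_sWord hL rep (b :: w) hw.tail (rngW G L [a]) ha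
    have e := rngW_append (G := G) (L := L) (w₁ := [a]) (w₂ := b :: w) (by simp) (by simp)
    have hb : Bbar G L (rngW G L (b :: w)) := Bbar.base _ hw.tail
    simp only [sWord]
    rw [star_mul, mul_assoc, ← mul_assoc (star (rep.s a)), rep.s_s, h2, ← mul_assoc, ih,
      rep.p_mul _ _ hb (Bbar.rel _ _ ha hw.tail), ← e]
    congr 1
    apply Set.inter_eq_right.2
    have := relRng_subset (G := G) (L := L) (rngW G L [a]) (b :: w)
    rwa [← e] at this

variable {B : Type*} [NonUnitalCStarAlgebra B]

lemma gauge_sWord {rep : LRep G L B} (ga : GaugeAction G L rep) (z : Circle) :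
    ∀ w : List 𝒜, w ≠ [] → ga.γ z (sWord rep.s w) = (z : ℂ) ^ w.length • sWord rep.s w
  | [], hw => absurd rfl hw
  | [a], _ => by simpa [sWord] using ga.γ_s z a
  | a :: b :: w, _ => by
    have ih := gauge_sWord ga z (b :: w) (by simp)
    simp only [sWord]
    rw [map_mul, ih, ga.γ_s, smul_mul_assoc, mul_smul_comm, smul_smul, List.length_cons (a := a),
      pow_succ']

lemma smooth_adjoin {rep : LRep G L B} (ga : GaugeAction G L rep) {x : B}
    (hx : x ∈ NonUnitalStarAlgebra.adjoin ℂ ({x : B | ∃ a : 𝒜, x = rep.s a} ∪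
      {x : B | ∃ A : Set V, Bbar G L A ∧ x = rep.p A})) :
    ∃ y', HasDerivAt (fun θ : ℝ => ga.γ (Circle.exp θ) x) y' 0 := by
  induction hx using NonUnitalStarAlgebra.adjoin_induction with
  | mem x hx =>
    rcases hx with ⟨a, rfl⟩ | ⟨A, hA, rfl⟩
    · simp only [ga.γ_s, Circle.coe_exp]
      have h1 : HasDerivAt (fun θ : ℝ => Complex.exp (θ * Complex.I)) _ 0 :=
        ((Complex.ofRealCLM.hasDerivAt (x := (0 : ℝ))).mul_const Complex.I).cexp
      exact ⟨_, h1.smul_const (rep.s a)⟩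
    · simp only [ga.γ_p _ A hA]
      exact ⟨0, hasDerivAt_const _ _⟩
  | add x y _ _ hx hy =>
    obtain ⟨x', hx⟩ := hx
    obtain ⟨y', hy⟩ := hy
    simp only [map_add]
    exact ⟨_, hx.add hy⟩
  | zero =>
    simp only [map_zero]
    exact ⟨0, hasDerivAt_const _ _⟩
  | mul x y _ _ hx hy =>
    obtain ⟨x', hx⟩ := hx
    obtain ⟨y', hy⟩ := hy
    simp only [map_mul]
    exact ⟨_, (ContinuousLinearMap.mul ℝ B).hasDerivAt_of_bilinear (fun _ => hx) (fun _ => hy)⟩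
  | smul c x _ hx =>
    obtain ⟨x', hx⟩ := hx
    simp only [map_smul]
    exact ⟨_, hx.const_smul c⟩
  | star x _ hx =>
    obtain ⟨x', hx⟩ := hx
    simp only [map_star]
    exact ⟨_, hx.star⟩

lemma wordPow_succ (α : List 𝒜) (m : ℕ) : wordPow α (m + 1) = α ++ wordPow α m := by
  simp [wordPow, List.replicate_succ]

lemma wordPow_succ' (α : List 𝒜) (m : ℕ) : wordPow α (m + 1) = wordPow α m ++ α := by
  simp [wordPow, List.replicate_succ']

end graphpart
/-- Theorem 4.8. Suppose `(E, L)` has no sinks or sources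
and let `{s_a, p_A}` be a representation of `(E, L, 𝔅̄)` in a C*-algebra `B`
generated by it, with `p_C ≠ 0` for every nonempty `C ∈ 𝔅̄`, admitting a
gauge action. If `α ∈ L*(E)` is a repeatable path and for some `m ≥ 1` the
projection `p_{r(α^m)}` does not lie in the closed two-sided ideal generated
by `p_{r(α^m) ∖ r(α^{m+1})}`, then `B` is not an AF algebra. -/
theorem repeatable_not_in_ideal_not_AF {V E 𝒜 B : Type*}
    [Countable V] [Countable E] [Countable 𝒜]
    [NonUnitalCStarAlgebra B]
    (G : DirGraph V E) (L : E → 𝒜) (hL : Function.Surjective L)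
    (hnosink : G.sinks = ∅) (hnosource : ∀ v : V, ∃ e, G.rng e = v)
    (sa : StandingAssumptions G L)
    (rep : LRep G L B)
    (hp : ∀ C : Set V, Bbar G L C → C.Nonempty → rep.p C ≠ 0)
    (hgen : GeneratesAlg G L rep)
    (ga : GaugeAction G L rep)
    (α : List 𝒜) (hα : IsLabelWord G L α) (hrep : Repeatable G L α)
    (hm : ∃ m : ℕ, 1 ≤ m ∧
      rep.p (rngW G L (wordPow α m)) ∉
        closedIdealGen B
          (rep.p (rngW G L (wordPow α m) \ rngW G L (wordPow α (m + 1))))) :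
    ¬ IsAFAlgebra B := by
  intro hAF
  obtain ⟨m, hm1, hpI⟩ := hm
  have hα0 : α ≠ [] := hα.ne_nil
  have hw : IsLabelWord G L (wordPow α m) := hrep m hm1
  have hw' : IsLabelWord G L (wordPow α (m + 1)) := hrep (m + 1) (by omega)
  have hw0 : wordPow α m ≠ [] := hw.ne_nil
  set A : Set V := rngW G L (wordPow α m) with hA
  set A' : Set V := rngW G L (wordPow α (m + 1)) with hA'
  have hBA : Bbar G L A := Bbar.base _ hw
  have hBA' : Bbar G L A' := Bbar.base _ hw'
  have hBd : Bbar G L (A \ A') := Bbar.diff _ _ hBA hBA'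
  have hBα : Bbar G L (rngW G L α) := Bbar.base _ hα
  have e1 : A' = relRng G L A α := by
    rw [hA', wordPow_succ', rngW_append hw0 hα0]
  have hsub1 : A' ⊆ rngW G L α := by rw [e1]; exact relRng_subset _ _
  have hsub2 : A' ⊆ A := by
    rw [hA', wordPow_succ, rngW_append hα0 hw0]; exact relRng_subset _ _
  have hpp : rep.p A * rep.p A = rep.p A := by rw [rep.p_mul _ _ hBA hBA, Set.inter_self]
  have hsum : rep.p A - rep.p (A \ A') = rep.p A' := by
    have h := rep.p_union A' (A \ A') hBA' hBd
    rw [Set.union_diff_cancel hsub2, Set.inter_diff_self, rep.p_empty, sub_zero] at h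
    rw [h, add_sub_cancel_right]
  have h1 : rep.p A * sWord rep.s α = sWord rep.s α * rep.p A' := by
    rw [e1]; exact p_sWord hL rep α hα A hBA
  have h2 := star_sWord hL rep α hα
  refine cstar_core hAF (p := rep.p A) (q := rep.p (A \ A')) (s := sWord rep.s α)
    (rep.p_sa A hBA) hpp ga.γ ga.γ_mul ga.γ_continuous (fun z => ga.γ_p z A hBA)
    (fun z => ga.γ_p z _ hBd) ?_ α.length (List.length_pos_iff.2 hα0)
    (fun z => gauge_sWord ga z α hα0) ?_ hpI
  · intro x ε hε
    have hx : x ∈ closure (NonUnitalStarAlgebra.adjoin ℂ ({x : B | ∃ a : 𝒜, x = rep.s a} ∪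
        {x : B | ∃ A : Set V, Bbar G L A ∧ x = rep.p A}) : Set B) := by
      have h : closure _ = Set.univ := hgen
      rw [h]; trivial
    obtain ⟨y, hy, hxy⟩ := Metric.mem_closure_iff.1 hx ε hε
    rw [dist_eq_norm] at hxy
    exact ⟨y, hxy, smooth_adjoin ga hy⟩
  · have h3 : rep.p A * star (sWord rep.s α) * rep.p A * (rep.p A * sWord rep.s α * rep.p A)
        = rep.p A * (star (sWord rep.s α) * ((rep.p A * rep.p A) * sWord rep.s α)) * rep.p A := by
      simp only [mul_assoc]
    rw [h3, hpp, h1, ← mul_assoc (star _), h2, rep.p_mul _ _ hBα hBA',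
      Set.inter_eq_right.2 hsub1, rep.p_mul _ _ hBA hBA', Set.inter_eq_right.2 hsub2,
      rep.p_mul _ _ hBA' hBA, Set.inter_eq_left.2 hsub2, hsum]

end
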